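/- Existence and uniqueness of the ground state: there exists a function Q : ℝ³ → ℝ that is smooth, strictly positive, radial (Q(p) depends only on |p|), tends to 0 as |p| → ∞, has Q and ∇Q square-integrable on ℝ³, and satisfies −ΔQ + Q − Q² = 0 on ℝ³. Moreover, Q is unique: any two functions with all of these properties coincide. -/

import Mathlib

noncomputable section

open MeasureTheory Filter Real

/-- Partial derivative in the first spatial variable. -/
def pdx (f : ℝ → ℝ → ℝ → ℝ) (x y z : ℝ) : ℝ := deriv (fun a => f a y z) x

/-- Partial derivative in the second spatial variable. -/
def pdy (f : ℝ → ℝ → ℝ → ℝ) (x y z : ℝ) : ℝ := deriv (fun b => f x b z) y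

/-- Partial derivative in the third spatial variable. -/
def pdz (f : ℝ → ℝ → ℝ → ℝ) (x y z : ℝ) : ℝ := deriv (fun c => f x y c) z

/-- Spatial Laplacian Δf = f_xx + f_yy + f_zz of a function of three real variables. -/
def lap3 (f : ℝ → ℝ → ℝ → ℝ) (x y z : ℝ) : ℝ :=
  deriv (fun a => deriv (fun a' => f a' y z) a) x
    + deriv (fun b => deriv (fun b' => f x b' z) b) y
    + deriv (fun c => deriv (fun c' => f x y c') c) z

/-- `u` solves the 3D Zakharov–Kuznetsov equation ∂ₜu + ∂ₓ(Δu + u²) = 0 pointwise. -/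
def IsZKSolution (u : ℝ → ℝ → ℝ → ℝ → ℝ) : Prop :=
  ∀ t x y z : ℝ,
    deriv (fun s => u s x y z) t
      + deriv (fun a => lap3 (u t) a y z + (u t a y z) ^ 2) x = 0

/-- `t ↦ u(t,·)` is a smooth curve in the Schwartz space 𝒮(ℝ³): the function is jointly
smooth and every time derivative of every time slice is a Schwartz function. -/
def IsSchwartzCurve (u : ℝ → ℝ → ℝ → ℝ → ℝ) : Prop :=
  ContDiff ℝ (⊤ : ℕ∞) (fun p : ℝ × ℝ × ℝ × ℝ => u p.1 p.2.1 p.2.2.1 p.2.2.2) ∧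
    ∀ (n : ℕ) (t : ℝ), ∃ S : SchwartzMap (ℝ × ℝ × ℝ) ℝ,
      ∀ x y z : ℝ, S (x, y, z) = iteratedDeriv n (fun s => u s x y z) t

/-- `Q` is the ground state: a positive radial smooth solution of −ΔQ + Q − Q² = 0 on ℝ³,
vanishing at infinity, with Q and ∇Q square-integrable. -/
def IsGroundState (Q : ℝ → ℝ → ℝ → ℝ) : Prop :=
  ContDiff ℝ (⊤ : ℕ∞) (fun p : ℝ × ℝ × ℝ => Q p.1 p.2.1 p.2.2) ∧
  (∀ x y z : ℝ, 0 < Q x y z) ∧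
  (∃ q : ℝ → ℝ, ∀ x y z : ℝ, Q x y z = q (Real.sqrt (x ^ 2 + y ^ 2 + z ^ 2))) ∧
  Tendsto (fun p : ℝ × ℝ × ℝ => Q p.1 p.2.1 p.2.2) (cocompact (ℝ × ℝ × ℝ)) (nhds 0) ∧
  Integrable (fun p : ℝ × ℝ × ℝ => (Q p.1 p.2.1 p.2.2) ^ 2) ∧
  Integrable (fun p : ℝ × ℝ × ℝ =>
    (pdx Q p.1 p.2.1 p.2.2) ^ 2 + (pdy Q p.1 p.2.1 p.2.2) ^ 2 + (pdz Q p.1 p.2.1 p.2.2) ^ 2) ∧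
  (∀ x y z : ℝ, -(lap3 Q x y z) + Q x y z - (Q x y z) ^ 2 = 0)

open Set Topology

/-- A differentiable function with nonpositive derivative decreases between the endpoints. -/
lemma le_of_hasDerivAt_nonpos {f f' : ℝ → ℝ} {a b : ℝ} (hab : a ≤ b)
    (hc : ContinuousOn f (Icc a b)) (hd : ∀ x ∈ Ioo a b, HasDerivAt f (f' x) x)
    (h : ∀ x ∈ Ioo a b, f' x ≤ 0) : f b ≤ f a := by
  have := antitoneOn_of_hasDerivWithinAt_nonpos (convex_Icc a b) hc (f' := f')
    (by rw [interior_Icc]; exact fun x hx => (hd x hx).hasDerivWithinAt)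
    (by rwa [interior_Icc])
  exact this (left_mem_Icc.2 hab) (right_mem_Icc.2 hab) hab

/-- A differentiable function with nonnegative derivative increases between the endpoints. -/
lemma le_of_hasDerivAt_nonneg {f f' : ℝ → ℝ} {a b : ℝ} (hab : a ≤ b)
    (hc : ContinuousOn f (Icc a b)) (hd : ∀ x ∈ Ioo a b, HasDerivAt f (f' x) x)
    (h : ∀ x ∈ Ioo a b, 0 ≤ f' x) : f a ≤ f b := by
  have := monotoneOn_of_hasDerivWithinAt_nonneg (convex_Icc a b) hc (f' := f')
    (by rw [interior_Icc]; exact fun x hx => (hd x hx).hasDerivWithinAt)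
    (by rwa [interior_Icc])
  exact this (left_mem_Icc.2 hab) (right_mem_Icc.2 hab) hab

/-- A differentiable function with negative derivative strictly decreases. -/
lemma lt_of_hasDerivAt_neg {f f' : ℝ → ℝ} {a b : ℝ} (hab : a < b)
    (hc : ContinuousOn f (Icc a b)) (hd : ∀ x ∈ Ioo a b, HasDerivAt f (f' x) x)
    (h : ∀ x ∈ Ioo a b, f' x < 0) : f b < f a := by
  have := strictAntiOn_of_hasDerivWithinAt_neg (convex_Icc a b) hc (f' := f')
    (by rw [interior_Icc]; exact fun x hx => (hd x hx).hasDerivWithinAt)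
    (by rwa [interior_Icc])
  exact this (left_mem_Icc.2 hab.le) (right_mem_Icc.2 hab.le) hab

/-- A continuous function that is negative at `a` and nonnegative at `b` has a first zero. -/
lemma exists_first_zero {f : ℝ → ℝ} {a b : ℝ} (hab : a ≤ b) (hc : ContinuousOn f (Icc a b))
    (ha : f a < 0) (hb : 0 ≤ f b) :
    ∃ c ∈ Ioc a b, f c = 0 ∧ ∀ x ∈ Ico a c, f x < 0 := by
  let S := Icc a b ∩ f ⁻¹' (Ici 0)
  have hS : IsClosed S := hc.preimage_isClosed_of_isClosed isClosed_Icc isClosed_Ici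
  have hne : S.Nonempty := ⟨b, right_mem_Icc.2 hab, hb⟩
  have hbd : BddBelow S := ⟨a, fun x hx => hx.1.1⟩
  have hmem : sInf S ∈ S := hS.csInf_mem hne hbd
  have hlt : ∀ x ∈ Ico a (sInf S), f x < 0 := by
    intro x hx
    by_contra hcon
    have : x ∈ S := ⟨⟨hx.1, hx.2.le.trans hmem.1.2⟩, not_lt.1 hcon⟩
    exact absurd (csInf_le hbd this) (not_le.2 hx.2)
  have hne' : a < sInf S := lt_of_le_of_ne hmem.1.1 (by
    intro h
    have h2 : 0 ≤ f (sInf S) := hmem.2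
    rw [← h] at h2
    linarith)
  refine ⟨sInf S, ⟨hne', hmem.1.2⟩, le_antisymm ?_ hmem.2, hlt⟩
  have h1 : ContinuousWithinAt f (Ico a (sInf S)) (sInf S) :=
    (hc _ hmem.1).mono (fun x hx => ⟨hx.1, hx.2.le.trans hmem.1.2⟩)
  have h2 : (𝓝[Ico a (sInf S)] (sInf S)).NeBot := by
    rw [← mem_closure_iff_nhdsWithin_neBot, closure_Ico hne'.ne]
    exact right_mem_Icc.2 hne'.le
  exact le_of_tendsto h1 (eventually_nhdsWithin_of_forall fun x hx => (hlt x hx).le)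

/-! ### The regularized second-order initial value problem `v'' = t G (v / t)` -/

section IVP

variable {G : ℝ → ℝ} {K B : NNReal}

lemma lipschitzWith_mul_comp_div (hG : LipschitzWith K G) (t : ℝ) :
    LipschitzWith K (fun x => t * G (x / t)) := by
  refine LipschitzWith.of_dist_le_mul fun x y => ?_
  rcases eq_or_ne t 0 with rfl | ht
  · simp
    positivity
  · have h := hG.dist_le_mul (x / t) (y / t)
    rw [Real.dist_eq, Real.dist_eq] at *
    rw [← mul_sub, abs_mul]
    rw [← sub_div, abs_div] at h
    have ht' : 0 < |t| := abs_pos.2 ht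
    calc |t| * |G (x / t) - G (y / t)| ≤ |t| * (K * (|x - y| / |t|)) := by gcongr
      _ = K * |x - y| := by field_simp

lemma continuous_mul_comp_div (hG : Continuous G) (hB : ∀ x, |G x| ≤ B) (x : ℝ) :
    Continuous (fun t => t * G (x / t)) := by
  rw [continuous_iff_continuousAt]
  intro t
  rcases eq_or_ne t 0 with rfl | ht
  · have h0 : Tendsto (fun t : ℝ => |t| * B) (𝓝 0) (𝓝 0) := by
      have : Continuous (fun t : ℝ => |t| * B) := by fun_prop
      simpa using this.tendsto 0
    have : Tendsto (fun t => t * G (x / t)) (𝓝 0) (𝓝 0) := by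
      refine squeeze_zero_norm (fun t => ?_) h0
      rw [Real.norm_eq_abs, abs_mul]
      gcongr
      exact hB _
    simpa [ContinuousAt] using this
  · have : ContinuousAt (fun t => x / t) t := continuousAt_const.div continuousAt_id ht
    exact continuousAt_id.mul (hG.continuousAt.comp this)

/-- The first-order system for `(v, v')`. -/
def radialField (G : ℝ → ℝ) (t : ℝ) (y : ℝ × ℝ) : ℝ × ℝ := (y.2, t * G (y.1 / t))

lemma lipschitzWith_radialField (hG : LipschitzWith K G) (t : ℝ) :
    LipschitzWith (max 1 K) (radialField G t) := by
  have h1 : LipschitzWith 1 (fun y : ℝ × ℝ => y.2) := LipschitzWith.prod_snd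
  have h2 : LipschitzWith (K * 1) (fun y : ℝ × ℝ => t * G (y.1 / t)) :=
    (lipschitzWith_mul_comp_div hG t).comp LipschitzWith.prod_fst
  rw [mul_one] at h2
  exact h1.prodMk h2

lemma exists_local_radial_solution (hG : LipschitzWith K G) (hB : ∀ x, |G x| ≤ B) (a : ℝ)
    {T : ℝ} (hT : 0 < T) :
    ∃ γ : ℝ → ℝ × ℝ, γ 0 = (0, a) ∧
      ∀ t ∈ Ioo (-T) T, HasDerivAt γ (radialField G t (γ t)) t := by
  -- Rescaling the second component makes the Picard–Lindelöf time restriction automatic.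
  let f : ℝ → ℝ × ℝ → ℝ × ℝ := fun t y => (y.2 / (2 * T), 2 * T * (t * G (y.1 / t)))
  let T' : NNReal := ⟨T, hT.le⟩
  let R : NNReal := 2 * T' * ‖a‖₊ + 2 * B * T' ^ 3
  have hTc : (T' : ℝ) = T := rfl
  have hpl : IsPicardLindelof f (tmin := -T) (tmax := T) ⟨0, by constructor <;> linarith⟩
      (0, 2 * T * a) R 0 (R / T') (max (1 / (2 * T')) (2 * T' * K)) := by
    refine ⟨fun t _ => ?_, fun x _ => ?_, fun t ht x hx => ?_, ?_⟩
    · have h1 : LipschitzWith (1 / (2 * T')) (fun y : ℝ × ℝ => y.2 / (2 * T)) := by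
        refine LipschitzWith.of_dist_le_mul fun x y => ?_
        rw [Real.dist_eq, ← sub_div, abs_div, abs_of_pos (by positivity : (0 : ℝ) < 2 * T)]
        have h3 : |x.2 - y.2| ≤ dist x y := by
          rw [← Real.dist_eq, Prod.dist_eq]; exact le_max_right _ _
        push_cast
        rw [hTc, div_eq_mul_one_div, mul_comm]
        gcongr
      have h2 : LipschitzWith (2 * T' * (K * 1))
          (fun y : ℝ × ℝ => 2 * T * (t * G (y.1 / t))) := by
        have h4 := (lipschitzWith_mul_comp_div hG t).comp
          (LipschitzWith.prod_fst (α := ℝ) (β := ℝ))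
        refine LipschitzWith.of_dist_le_mul fun x y => ?_
        have h5 := h4.dist_le_mul x y
        simp only [Function.comp_apply, Real.dist_eq] at h5 ⊢
        rw [← mul_sub, abs_mul, abs_of_pos (by positivity : (0 : ℝ) < 2 * T)]
        push_cast at h5 ⊢
        rw [hTc, mul_assoc (2 * T)]
        gcongr
      rw [mul_one] at h2
      exact (h1.prodMk h2).lipschitzOnWith
    · have := continuous_mul_comp_div hG.continuous hB x.1
      exact Continuous.continuousOn (by fun_prop)
    · have hx2 : |x.2 - 2 * T * a| ≤ R := by
        have h6 : dist x (0, 2 * T * a) ≤ R := by simpa using hx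
        rw [Prod.dist_eq] at h6
        exact (le_max_right _ _).trans h6
      have hR1 : 2 * T * |a| ≤ R := by
        have : (R : ℝ) = 2 * T * |a| + 2 * B * T ^ 3 := by simp [R, hTc]
        rw [this]
        have : (0 : ℝ) ≤ 2 * B * T ^ 3 := by positivity
        linarith
      have hR2 : 2 * B * T ^ 3 ≤ R := by
        have : (R : ℝ) = 2 * T * |a| + 2 * B * T ^ 3 := by simp [R, hTc]
        rw [this]
        have : (0 : ℝ) ≤ 2 * T * |a| := by positivity
        linarith
      have hxa : |x.2| ≤ 2 * R := by
        have h7 : |2 * T * a| = 2 * T * |a| := by rw [abs_mul, abs_of_pos (by positivity)]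
        have h8 := abs_sub_abs_le_abs_sub x.2 (2 * T * a)
        linarith
      have htT : |t| ≤ T := abs_le.2 ht
      push_cast
      rw [hTc, Prod.norm_def]
      refine max_le ?_ ?_
      · rw [Real.norm_eq_abs, abs_div, abs_of_pos (by positivity : (0 : ℝ) < 2 * T),
          div_le_div_iff₀ (by positivity) hT]
        nlinarith
      · rw [Real.norm_eq_abs, abs_mul, abs_of_pos (by positivity : (0 : ℝ) < 2 * T), abs_mul,
          le_div_iff₀ hT]
        have h9 : |t| * |G (x.1 / t)| ≤ T * B := by
          gcongr
          exact hB _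
        calc 2 * T * (|t| * |G (x.1 / t)|) * T ≤ 2 * T * (T * B) * T := by gcongr
          _ = 2 * B * T ^ 3 := by ring
          _ ≤ R := hR2
    · simp only [sub_zero, zero_sub, neg_neg, max_self]
      push_cast
      rw [hTc, div_mul_cancel₀ _ hT.ne']
      simp
  obtain ⟨α, h0, hα⟩ := hpl.exists_eq_forall_mem_Icc_hasDerivWithinAt₀
  refine ⟨fun t => ((α t).1, (α t).2 / (2 * T)), ?_, fun t ht => ?_⟩
  · have h0' : α 0 = (0, 2 * T * a) := h0
    simp only [h0', Prod.mk.injEq, true_and]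
    field_simp
  · have hd := (hα t (Ioo_subset_Icc_self ht)).hasDerivAt (Icc_mem_nhds ht.1 ht.2)
    have h1 : HasDerivAt (fun t => (α t).1) ((α t).2 / (2 * T)) t :=
      (ContinuousLinearMap.fst ℝ ℝ ℝ).hasFDerivAt.comp_hasDerivAt t hd
    have h2 : HasDerivAt (fun t => (α t).2) (2 * T * (t * G ((α t).1 / t))) t :=
      (ContinuousLinearMap.snd ℝ ℝ ℝ).hasFDerivAt.comp_hasDerivAt t hd
    refine h1.prodMk ((h2.div_const (2 * T)).congr_deriv ?_)
    field_simp

lemma exists_global_radial_solution (hG : LipschitzWith K G) (hB : ∀ x, |G x| ≤ B) (a : ℝ) :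
    ∃ γ : ℝ → ℝ × ℝ, γ 0 = (0, a) ∧ ∀ t, HasDerivAt γ (radialField G t (γ t)) t := by
  have hloc := fun n : ℕ => exists_local_radial_solution hG hB a (T := (n : ℝ) + 1) (by positivity)
  choose γ h0 hγ using hloc
  have hagree : ∀ m n : ℕ, ∀ t : ℝ, |t| < m + 1 → |t| < n + 1 → γ m t = γ n t := by
    intro m n t hm hn
    have hsub : ∀ k : ℕ, min (m : ℝ) n ≤ k → ∀ s ∈ Ioo (-(min (m : ℝ) n + 1)) (min (m : ℝ) n + 1),
        HasDerivAt (γ k) (radialField G s (γ k s)) s ∧ γ k s ∈ (univ : Set (ℝ × ℝ)) := by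
      intro k hk s hs
      exact ⟨hγ k s ⟨by linarith [hs.1], by linarith [hs.2]⟩, mem_univ _⟩
    refine ODE_solution_unique_of_mem_Ioo (v := radialField G) (s := fun _ => univ) (t₀ := 0)
      (fun s _ => (lipschitzWith_radialField hG s).lipschitzOnWith) ?_
      (hsub m (min_le_left _ _)) (hsub n (min_le_right _ _)) ((h0 m).trans (h0 n).symm) ?_
    · have : (0 : ℝ) ≤ min (m : ℝ) n := by positivity
      constructor <;> linarith
    · rw [mem_Ioo, ← abs_lt, ← min_add_add_right]
      exact lt_min hm hn
  refine ⟨fun t => γ ⌈|t|⌉₊ t, by simp [h0], fun t => ?_⟩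
  have hceil : ∀ s : ℝ, |s| < (⌈|s|⌉₊ : ℝ) + 1 := fun s => (Nat.le_ceil _).trans_lt (by linarith)
  have heq : (fun s => γ ⌈|s|⌉₊ s) =ᶠ[𝓝 t] γ ⌈|t|⌉₊ := by
    have : ∀ᶠ s in 𝓝 t, |s| < (⌈|t|⌉₊ : ℝ) + 1 :=
      continuous_abs.continuousAt.eventually_lt continuousAt_const (hceil t)
    filter_upwards [this] with s hs
    exact hagree _ _ s (hceil s) hs
  exact (hγ _ t (abs_lt.1 (hceil t))).congr_of_eventuallyEq heq

/-- The initial value problem `v'' = t G (v / t)`, `v 0 = 0`, `v' 0 = a` has global solutions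
depending continuously on `a`. -/
lemma exists_radial_flow (hG : LipschitzWith K G) (hB : ∀ x, |G x| ≤ B) :
    ∃ v w : ℝ → ℝ → ℝ, (∀ a, v a 0 = 0) ∧ (∀ a, w a 0 = a) ∧
      (∀ a t, HasDerivAt (v a) (w a t) t) ∧
      (∀ a t, HasDerivAt (w a) (t * G (v a t / t)) t) ∧
      (∀ t, 0 ≤ t → Continuous fun a => v a t) ∧ ∀ t, 0 ≤ t → Continuous fun a => w a t := by
  choose γ h0 hγ using exists_global_radial_solution hG hB
  have hcont : ∀ t, 0 ≤ t → Continuous fun a => γ a t := by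
    intro t ht
    have hc : ∀ a, Continuous (γ a) := fun a =>
      continuous_iff_continuousAt.2 fun s => (hγ a s).continuousAt
    refine (LipschitzWith.of_dist_le_mul
      (K := ⟨rexp ((max 1 K : NNReal) * (t - 0)), (exp_pos _).le⟩) fun a b => ?_).continuous
    refine (dist_le_of_trajectories_ODE (v := radialField G) (a := 0) (b := t) (δ := dist a b)
      (lipschitzWith_radialField hG) (hc a).continuousOn
      (fun s _ => (hγ a s).hasDerivWithinAt) (hc b).continuousOn
      (fun s _ => (hγ b s).hasDerivWithinAt) ?_ t ⟨ht, le_rfl⟩).trans_eq (mul_comm _ _)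
    rw [h0, h0, Prod.dist_eq]
    simp
  refine ⟨fun a t => (γ a t).1, fun a t => (γ a t).2, fun a => by simp [h0],
    fun a => by simp [h0], fun a t => ?_, fun a t => ?_, fun t ht => (hcont t ht).fst,
    fun t ht => (hcont t ht).snd⟩
  · exact (ContinuousLinearMap.fst ℝ ℝ ℝ).hasFDerivAt.comp_hasDerivAt t (hγ a t)
  · exact (ContinuousLinearMap.snd ℝ ℝ ℝ).hasFDerivAt.comp_hasDerivAt t (hγ a t)

end IVP

/-- A differentiable function with positive derivative strictly increases. -/
lemma lt_of_hasDerivAt_pos {f f' : ℝ → ℝ} {a b : ℝ} (hab : a < b)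
    (hc : ContinuousOn f (Icc a b)) (hd : ∀ x ∈ Ioo a b, HasDerivAt f (f' x) x)
    (h : ∀ x ∈ Ioo a b, 0 < f' x) : f a < f b := by
  have := lt_of_hasDerivAt_neg hab hc.neg (fun x hx => (hd x hx).neg)
    (fun x hx => neg_lt_zero.2 (h x hx))
  simpa using this

/-- `u` is a positive solution of `u'' + 2 u' / r = u - u ^ 2` on the half-line, regular at the
origin and vanishing at infinity; `du` is its derivative. -/
structure IsDecayingProfile (u du : ℝ → ℝ) : Prop where
  continuousOn : ContinuousOn u (Ici 0)
  tendsto_du : Tendsto du (𝓝[>] 0) (𝓝 0)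
  hasDerivAt : ∀ r, 0 < r → HasDerivAt u (du r) r
  hasDerivAt_du : ∀ r, 0 < r → HasDerivAt du (u r - u r ^ 2 - 2 / r * du r) r
  pos : ∀ r, 0 ≤ r → 0 < u r
  tendsto : Tendsto u atTop (𝓝 0)

namespace IsDecayingProfile

variable {u du : ℝ → ℝ}

lemma hasDerivAt_mul (h : IsDecayingProfile u du) {r : ℝ} (hr : 0 < r) :
    HasDerivAt (fun r => r * u r) (u r + r * du r) r :=
  ((hasDerivAt_id r).mul (h.hasDerivAt r hr)).congr_deriv (by simp)

lemma hasDerivAt_mul_deriv (h : IsDecayingProfile u du) {r : ℝ} (hr : 0 < r) :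
    HasDerivAt (fun r => u r + r * du r) (r * (u r - u r ^ 2)) r :=
  ((h.hasDerivAt r hr).add ((hasDerivAt_id r).mul (h.hasDerivAt_du r hr))).congr_deriv (by
    simp; field_simp; ring)

/-- The logarithmic derivative of `r u` is at least `-1`. -/
lemma neg_mul_le (h : IsDecayingProfile u du) {r₀ : ℝ} (hr₀ : 0 < r₀) :
    -(r₀ * u r₀) ≤ u r₀ + r₀ * du r₀ := by
  by_contra hcon
  set z : ℝ → ℝ := fun r => (u r + r * du r) + r * u r with hz
  have hz0 : z r₀ < 0 := by simp only [hz]; linarith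
  have hzd : ∀ r, 0 < r → HasDerivAt z (r * (u r - u r ^ 2) + (u r + r * du r)) r :=
    fun r hr => (h.hasDerivAt_mul_deriv hr).add (h.hasDerivAt_mul hr)
  have hexp : ∀ r : ℝ, HasDerivAt (fun r => rexp r) (rexp r) r := Real.hasDerivAt_exp
  have hexpn : ∀ r : ℝ, HasDerivAt (fun r => rexp (-r)) (-rexp (-r)) r := fun r =>
    ((hasDerivAt_neg r).exp).congr_deriv (by ring)
  have h1 : ∀ r, r₀ ≤ r → z r * rexp (-r) ≤ z r₀ * rexp (-r₀) := by
    intro r hr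
    have hd : ∀ x, r₀ ≤ x → HasDerivAt (fun x => z x * rexp (-x))
        (-(x * u x ^ 2) * rexp (-x)) x := fun x hx =>
      ((hzd x (hr₀.trans_le hx)).mul (hexpn x)).congr_deriv (by simp only [hz]; ring)
    refine le_of_hasDerivAt_nonpos hr (HasDerivAt.continuousOn fun x hx => hd x hx.1)
      (fun x hx => hd x hx.1.le) fun x hx => ?_
    have : 0 < x := hr₀.trans hx.1
    have : 0 ≤ x * u x ^ 2 * rexp (-x) := by positivity
    linarith
  set κ := -(z r₀ * rexp (-r₀)) with hκ
  have hκ0 : 0 < κ := by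
    have := mul_neg_of_neg_of_pos hz0 (exp_pos (-r₀))
    linarith
  have h2 : ∀ r, r₀ ≤ r → r * u r * rexp r + κ * r ≤ r₀ * u r₀ * rexp r₀ + κ * r₀ := by
    intro r hr
    have hd : ∀ x, r₀ ≤ x → HasDerivAt (fun x => x * u x * rexp x + κ * x)
        (z x * rexp x + κ) x := fun x hx =>
      (((h.hasDerivAt_mul (hr₀.trans_le hx)).mul (hexp x)).add
        ((hasDerivAt_id x).const_mul κ)).congr_deriv (by simp only [hz]; ring)
    refine le_of_hasDerivAt_nonpos hr (HasDerivAt.continuousOn fun x hx => hd x hx.1)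
      (fun x hx => hd x hx.1.le) fun x hx => ?_
    have hx0 : 0 < x := hr₀.trans hx.1
    have h3 := h1 x hx.1.le
    have h4 : 1 ≤ rexp x := one_le_exp hx0.le
    have h5 : z x * rexp x = (z x * rexp (-x)) * (rexp x * rexp x) := by
      rw [exp_neg]; field_simp
    have h6 : 1 ≤ rexp x * rexp x := by nlinarith
    rw [h5]
    nlinarith
  obtain ⟨n, hn⟩ := exists_nat_gt ((r₀ * u r₀ * rexp r₀ + κ * r₀) / κ)
  have hn' := (div_lt_iff₀ hκ0).1 hn
  have h7 := h2 (r₀ + n) (by linarith [n.cast_nonneg (α := ℝ)])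
  have hp : 0 < r₀ + n := by positivity
  have h8 : 0 < (r₀ + n) * u (r₀ + n) * rexp (r₀ + n) := by
    have := h.pos _ hp.le
    positivity
  nlinarith

/-- Far out, the logarithmic derivative of `r u` is at most `-1/2`. -/
lemma exists_le_neg_half_mul (h : IsDecayingProfile u du) :
    ∃ R, 1 ≤ R ∧ ∀ r, R ≤ r → u r + r * du r ≤ -(r * u r / 2) := by
  obtain ⟨R₀, hR₀⟩ := eventually_atTop.1
    (h.tendsto.eventually (gt_mem_nhds (by norm_num : (0 : ℝ) < 3 / 4)))
  refine ⟨max R₀ 1, le_max_right _ _, fun r₀ hr => ?_⟩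
  have hr₀ : 0 < r₀ := one_pos.trans_le ((le_max_right _ _).trans hr)
  have hu : ∀ x, r₀ ≤ x → u x < 3 / 4 := fun x hx => hR₀ x ((le_max_left _ _).trans (hr.trans hx))
  by_contra hcon
  set z : ℝ → ℝ := fun r => (u r + r * du r) + r * u r / 2 with hz
  have hz0 : 0 < z r₀ := by simp only [hz]; linarith
  have hzd : ∀ r, 0 < r → HasDerivAt z (r * (u r - u r ^ 2) + (u r + r * du r) / 2) r :=
    fun r hr => (h.hasDerivAt_mul_deriv hr).add ((h.hasDerivAt_mul hr).div_const 2)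
  have hexp : ∀ r : ℝ, HasDerivAt (fun r => rexp (r / 2)) (rexp (r / 2) / 2) r := fun r =>
    (((hasDerivAt_id r).div_const 2).exp).congr_deriv (by simp; ring)
  have hexpn : ∀ r : ℝ, HasDerivAt (fun r => rexp (-r / 2)) (-rexp (-r / 2) / 2) r := fun r =>
    (((hasDerivAt_neg r).div_const 2).exp).congr_deriv (by ring)
  have h1 : ∀ r, r₀ ≤ r → z r₀ * rexp (-r₀ / 2) ≤ z r * rexp (-r / 2) := by
    intro r hr
    have hd : ∀ x, r₀ ≤ x → HasDerivAt (fun x => z x * rexp (-x / 2))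
        (x * u x * (3 / 4 - u x) * rexp (-x / 2)) x := fun x hx =>
      ((hzd x (hr₀.trans_le hx)).mul (hexpn x)).congr_deriv (by simp only [hz]; ring)
    refine le_of_hasDerivAt_nonneg hr (HasDerivAt.continuousOn fun x hx => hd x hx.1)
      (fun x hx => hd x hx.1.le) fun x hx => ?_
    have hx0 : 0 < x := hr₀.trans hx.1
    have h2 := h.pos x hx0.le
    have h3 : 0 ≤ 3 / 4 - u x := by linarith [hu x hx.1.le]
    positivity
  set κ := z r₀ * rexp (-r₀ / 2) with hκ
  have hκ0 : 0 < κ := by positivity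
  have h2 : ∀ r, r₀ ≤ r → r₀ * u r₀ * rexp (r₀ / 2) - κ * rexp r₀ ≤
      r * u r * rexp (r / 2) - κ * rexp r := by
    intro r hr
    have hd : ∀ x, r₀ ≤ x → HasDerivAt (fun x => x * u x * rexp (x / 2) - κ * rexp x)
        (z x * rexp (x / 2) - κ * rexp x) x := fun x hx =>
      (((h.hasDerivAt_mul (hr₀.trans_le hx)).mul (hexp x)).sub
        ((Real.hasDerivAt_exp x).const_mul κ)).congr_deriv (by simp only [hz]; ring)
    refine le_of_hasDerivAt_nonneg hr (HasDerivAt.continuousOn fun x hx => hd x hx.1)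
      (fun x hx => hd x hx.1.le) fun x hx => ?_
    have h3 := h1 x hx.1.le
    have h5 : z x * rexp (x / 2) = (z x * rexp (-x / 2)) * rexp x := by
      rw [mul_assoc, ← exp_add]; ring_nf
    rw [h5]
    have := exp_pos x
    nlinarith
  set C := r₀ * u r₀ * rexp (r₀ / 2) - κ * rexp r₀ with hC
  have h3 : ∀ r, r₀ ≤ r → κ ≤ 2 * ((r / 2) ^ 1 * rexp (-(r / 2))) + |C| * rexp (-r) := by
    intro r hr
    have h4 := h2 r hr
    have h5 := hu r hr
    have hr0 : 0 < r := hr₀.trans_le hr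
    have h6 : r * u r * rexp (r / 2) ≤ r * rexp (r / 2) := by
      have := exp_pos (r / 2)
      have : r * u r ≤ r * 1 := by gcongr; linarith
      nlinarith
    have h7 : κ * rexp r ≤ r * rexp (r / 2) + |C| := by linarith [neg_abs_le C]
    have h8 : κ = κ * rexp r * rexp (-r) := by rw [mul_assoc, ← exp_add]; simp
    rw [h8]
    calc κ * rexp r * rexp (-r) ≤ (r * rexp (r / 2) + |C|) * rexp (-r) := by gcongr
      _ = _ := by
        rw [add_mul, mul_assoc, ← exp_add]; ring_nf
  have hlim : Tendsto (fun r : ℝ => 2 * ((r / 2) ^ 1 * rexp (-(r / 2))) + |C| * rexp (-r)) atTop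
      (𝓝 (2 * 0 + |C| * 0)) := by
    refine Tendsto.add (Tendsto.const_mul _ ?_) (Tendsto.const_mul _ ?_)
    · exact (Real.tendsto_pow_mul_exp_neg_atTop_nhds_zero 1).comp
        (tendsto_id.atTop_div_const (by norm_num : (0 : ℝ) < 2))
    · exact tendsto_exp_neg_atTop_nhds_zero
  have := ge_of_tendsto hlim (eventually_atTop.2 ⟨r₀, h3⟩)
  simp at this
  linarith

/-- Exponential decay of a profile, and control of its derivative. -/
lemma exists_decay (h : IsDecayingProfile u du) :
    ∃ R C, 1 ≤ R ∧ 0 < C ∧ ∀ r, R ≤ r → u r ≤ C * rexp (-r / 2) ∧ |du r| ≤ 2 * u r := by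
  obtain ⟨R, hR1, hR⟩ := h.exists_le_neg_half_mul
  have hR0 : 0 < R := by linarith
  refine ⟨R, R * u R * rexp (R / 2), hR1, ?_, fun r hr => ⟨?_, ?_⟩⟩
  · have := h.pos R hR0.le
    positivity
  · have hexp : ∀ r : ℝ, HasDerivAt (fun r => rexp (r / 2)) (rexp (r / 2) / 2) r := fun r =>
      (((hasDerivAt_id r).div_const 2).exp).congr_deriv (by simp; ring)
    have hd : ∀ x, R ≤ x → HasDerivAt (fun x => x * u x * rexp (x / 2))
        ((u x + x * du x + x * u x / 2) * rexp (x / 2)) x := fun x hx =>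
      ((h.hasDerivAt_mul (hR0.trans_le hx)).mul (hexp x)).congr_deriv (by ring)
    have h1 := le_of_hasDerivAt_nonpos hr (HasDerivAt.continuousOn fun x hx => hd x hx.1)
      (fun x hx => hd x hx.1.le) fun x hx =>
        mul_nonpos_of_nonpos_of_nonneg (by linarith [hR x hx.1.le]) (exp_pos _).le
    have h2 : u r ≤ r * u r := by
      have := h.pos r (by linarith)
      nlinarith
    calc u r ≤ r * u r := h2
      _ = r * u r * rexp (r / 2) * rexp (-r / 2) := by
        rw [mul_assoc _ (rexp _), ← exp_add]; ring_nf; simp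
      _ ≤ _ := by gcongr
  · have hr0 : 0 < r := by linarith
    have h1 := h.neg_mul_le hr0
    have h2 := hR r hr
    have h3 := h.pos r hr0.le
    have h4 : 0 < r * u r := by positivity
    rw [abs_le]
    constructor
    · by_contra hcon
      have : r * du r < r * (-(2 * u r)) := by gcongr; linarith
      nlinarith
    · by_contra hcon
      have : r * (2 * u r) < r * du r := by gcongr; linarith
      nlinarith

end IsDecayingProfile

/-- The generalized Pohozaev functional, chosen so that its derivative along solutions involves
only `u ^ 2`. -/
def pohozaev (u du : ℝ → ℝ) (r : ℝ) : ℝ :=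
  r ^ (2 / 5 : ℝ) * (r ^ 2 * du r ^ 2 / 2 + 4 / 5 * r * u r * du r + 6 / 25 * u r ^ 2
    - r ^ 2 * u r ^ 2 / 2 + r ^ 2 * u r ^ 3 / 3)

lemma pohozaev_zero (u du : ℝ → ℝ) : pohozaev u du 0 = 0 := by
  simp [pohozaev, Real.zero_rpow]

namespace IsDecayingProfile

variable {u du : ℝ → ℝ}

lemma hasDerivAt_pohozaev (h : IsDecayingProfile u du) {r : ℝ} (hr : 0 < r) :
    HasDerivAt (pohozaev u du)
      (r ^ (2 / 5 : ℝ) * ((12 / 125 / r - 2 / 5 * r) * u r ^ 2)) r := by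
  have hu := h.hasDerivAt r hr
  have hdu := h.hasDerivAt_du r hr
  have hid := hasDerivAt_id r
  have hp : HasDerivAt (fun r : ℝ => r ^ (2 / 5 : ℝ)) (2 / 5 * (r ^ (2 / 5 : ℝ) / r)) r :=
    (Real.hasDerivAt_rpow_const (Or.inl hr.ne')).congr_deriv (by
      rw [Real.rpow_sub_one hr.ne'])
  have hb := ((((((hid.pow 2).mul (hdu.pow 2)).div_const 2).add
    (((hid.const_mul (4 / 5)).mul hu).mul hdu)).add ((hu.pow 2).const_mul (6 / 25))).sub
    (((hid.pow 2).mul (hu.pow 2)).div_const 2)).add (((hid.pow 2).mul (hu.pow 3)).div_const 3)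
  refine (hp.mul hb).congr_deriv ?_
  simp
  field_simp
  ring

lemma tendsto_zero_right (h : IsDecayingProfile u du) : Tendsto u (𝓝[>] 0) (𝓝 (u 0)) :=
  (h.continuousOn 0 self_mem_Ici).mono_left (nhdsWithin_mono _ Ioi_subset_Ici_self)

lemma tendsto_pohozaev_zero (h : IsDecayingProfile u du) :
    Tendsto (pohozaev u du) (𝓝[>] 0) (𝓝 0) := by
  have hu := h.tendsto_zero_right
  have hdu := h.tendsto_du
  have hid : Tendsto (fun r : ℝ => r) (𝓝[>] 0) (𝓝 0) := tendsto_id.mono_left nhdsWithin_le_nhds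
  have hp : Tendsto (fun r : ℝ => r ^ (2 / 5 : ℝ)) (𝓝[>] 0) (𝓝 0) := by
    have : ContinuousAt (fun r : ℝ => r ^ (2 / 5 : ℝ)) 0 :=
      Real.continuousAt_rpow_const _ _ (Or.inr (by norm_num))
    have h2 := this.tendsto.mono_left (nhdsWithin_le_nhds (s := Ioi 0))
    simpa [Real.zero_rpow] using h2
  have hb := ((((((hid.pow 2).mul (hdu.pow 2)).div_const 2).add
    (((hid.const_mul (4 / 5)).mul hu).mul hdu)).add ((hu.pow 2).const_mul (6 / 25))).sub
    (((hid.pow 2).mul (hu.pow 2)).div_const 2)).add (((hid.pow 2).mul (hu.pow 3)).div_const 3)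
  have := hp.mul hb
  rw [zero_mul] at this
  exact this

lemma continuousOn_pohozaev (h : IsDecayingProfile u du) :
    ContinuousOn (pohozaev u du) (Ici 0) := by
  intro r hr
  rcases eq_or_lt_of_le (mem_Ici.1 hr) with rfl | hr
  · rw [← continuousWithinAt_Ioi_iff_Ici, ContinuousWithinAt, pohozaev_zero]
    exact h.tendsto_pohozaev_zero
  · exact (h.hasDerivAt_pohozaev hr).continuousAt.continuousWithinAt

lemma exists_abs_pohozaev_le (h : IsDecayingProfile u du) :
    ∃ R C, 1 ≤ R ∧ ∀ r, R ≤ r → |pohozaev u du r| ≤ C * r ^ 3 * u r ^ 2 := by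
  obtain ⟨R, C, hR, hC, hdec⟩ := h.exists_decay
  refine ⟨R, 5 + C, hR, fun r hr => ?_⟩
  obtain ⟨h1, h2⟩ := hdec r hr
  have hr1 : 1 ≤ r := hR.trans hr
  have hr0 : 0 < r := by linarith
  have hu := h.pos r hr0.le
  have huC : u r ≤ C := h1.trans (by
    have : rexp (-r / 2) ≤ 1 := exp_le_one_iff.2 (by linarith)
    nlinarith)
  rw [pohozaev, abs_mul, abs_of_pos (rpow_pos_of_pos hr0 _)]
  have hp : r ^ (2 / 5 : ℝ) ≤ r := by
    calc r ^ (2 / 5 : ℝ) ≤ r ^ (1 : ℝ) := rpow_le_rpow_of_exponent_le hr1 (by norm_num)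
      _ = r := rpow_one r
  have hrr : r ≤ r ^ 2 := by nlinarith
  have hr2 : 1 ≤ r ^ 2 := by nlinarith
  have hb : |r ^ 2 * du r ^ 2 / 2 + 4 / 5 * r * u r * du r + 6 / 25 * u r ^ 2
      - r ^ 2 * u r ^ 2 / 2 + r ^ 2 * u r ^ 3 / 3| ≤ (5 + C) * r ^ 2 * u r ^ 2 := by
    have e1 : |r ^ 2 * du r ^ 2 / 2| ≤ 2 * (r ^ 2 * u r ^ 2) := by
      rw [abs_of_nonneg (by positivity), ← sq_abs (du r)]
      have : |du r| ^ 2 ≤ (2 * u r) ^ 2 := by gcongr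
      nlinarith [sq_nonneg r]
    have e2 : |4 / 5 * r * u r * du r| ≤ 8 / 5 * (r ^ 2 * u r ^ 2) := by
      rw [abs_mul, abs_of_pos (by positivity : 0 < 4 / 5 * r * u r)]
      calc 4 / 5 * r * u r * |du r| ≤ 4 / 5 * r ^ 2 * u r * (2 * u r) := by gcongr
        _ = _ := by ring
    have e3 : |6 / 25 * u r ^ 2| ≤ 6 / 25 * (r ^ 2 * u r ^ 2) := by
      rw [abs_of_pos (by positivity)]
      nlinarith [sq_nonneg (u r)]
    have e4 : |r ^ 2 * u r ^ 2 / 2| = r ^ 2 * u r ^ 2 / 2 := abs_of_pos (by positivity)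
    have e5 : |r ^ 2 * u r ^ 3 / 3| ≤ C * (r ^ 2 * u r ^ 2) / 3 := by
      rw [abs_of_pos (by positivity)]
      have : r ^ 2 * u r ^ 3 = u r * (r ^ 2 * u r ^ 2) := by ring
      rw [this]
      gcongr
    have hpos : 0 ≤ r ^ 2 * u r ^ 2 := by positivity
    have hpos' : 0 ≤ C * (r ^ 2 * u r ^ 2) := by positivity
    rw [abs_le] at *
    constructor <;> nlinarith [e1.1, e1.2, e2.1, e2.2, e3.1, e3.2, e5.1, e5.2]
  calc r ^ (2 / 5 : ℝ) * |_| ≤ r * ((5 + C) * r ^ 2 * u r ^ 2) := by gcongr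
    _ = _ := by ring

lemma tendsto_pow_mul_sq (h : IsDecayingProfile u du) (C : ℝ) :
    Tendsto (fun r => C * r ^ 3 * u r ^ 2) atTop (𝓝 0) := by
  obtain ⟨R, C', hR, hC, hdec⟩ := h.exists_decay
  have hlim : Tendsto (fun r : ℝ => |C| * C' ^ 2 * (r ^ 3 * rexp (-r))) atTop (𝓝 0) := by
    simpa using (Real.tendsto_pow_mul_exp_neg_atTop_nhds_zero 3).const_mul (|C| * C' ^ 2)
  refine squeeze_zero_norm' ?_ hlim
  filter_upwards [eventually_ge_atTop R] with r hr
  have hr0 : 0 < r := by linarith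
  have hu := h.pos r hr0.le
  rw [Real.norm_eq_abs, abs_mul, abs_mul, abs_of_pos (by positivity : 0 < r ^ 3),
    abs_of_pos (by positivity : 0 < u r ^ 2)]
  calc |C| * r ^ 3 * u r ^ 2 ≤ |C| * r ^ 3 * (C' * rexp (-r / 2)) ^ 2 := by
        gcongr
        exact (hdec r hr).1
    _ = |C| * C' ^ 2 * (r ^ 3 * (rexp (-r / 2) * rexp (-r / 2))) := by ring
    _ = _ := by rw [← exp_add]; ring_nf

lemma tendsto_pohozaev_atTop (h : IsDecayingProfile u du) :
    Tendsto (pohozaev u du) atTop (𝓝 0) := by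
  obtain ⟨R, C, hR, hb⟩ := h.exists_abs_pohozaev_le
  refine squeeze_zero_norm' ?_ (h.tendsto_pow_mul_sq C)
  filter_upwards [eventually_ge_atTop R] with r hr using hb r hr

lemma pohozaev_pos (h : IsDecayingProfile u du) {r : ℝ} (hr : 0 < r) : 0 < pohozaev u du r := by
  rcases le_or_gt (r ^ 2) (6 / 25) with hle | hgt
  · rw [← pohozaev_zero u du]
    refine lt_of_hasDerivAt_pos hr (h.continuousOn_pohozaev.mono Icc_subset_Ici_self)
      (fun x hx => h.hasDerivAt_pohozaev hx.1) fun x hx => ?_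
    have hx0 : 0 < x := hx.1
    have h1 := h.pos x hx0.le
    have h2 : 0 < 12 / 125 / x - 2 / 5 * x := by
      have : 12 / 125 / x - 2 / 5 * x = (12 / 125 - 2 / 5 * x ^ 2) / x := by field_simp
      rw [this]
      have : x ^ 2 < r ^ 2 := by gcongr; exact hx.2
      apply div_pos _ hx0
      linarith
    have h3 := rpow_pos_of_pos hx0 (2 / 5)
    positivity
  · have hneg : ∀ x, r < x → x ^ (2 / 5 : ℝ) * ((12 / 125 / x - 2 / 5 * x) * u x ^ 2) < 0 := by
      intro x hx
      have hx0 : 0 < x := hr.trans hx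
      have h1 := h.pos x hx0.le
      have h2 : 12 / 125 / x - 2 / 5 * x < 0 := by
        have : 12 / 125 / x - 2 / 5 * x = (12 / 125 - 2 / 5 * x ^ 2) / x := by field_simp
        rw [this]
        have : r ^ 2 < x ^ 2 := by gcongr
        apply div_neg_of_neg_of_pos _ hx0
        linarith
      have h3 := rpow_pos_of_pos hx0 (2 / 5)
      exact mul_neg_of_pos_of_neg h3 (mul_neg_of_neg_of_pos h2 (by positivity))
    have hlt : ∀ x y, r ≤ x → x < y → pohozaev u du y < pohozaev u du x := by
      intro x y hx hxy
      exact lt_of_hasDerivAt_neg hxy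
        (h.continuousOn_pohozaev.mono fun z hz => (hr.le.trans hx).trans hz.1)
        (fun z hz => h.hasDerivAt_pohozaev (hr.trans_le (hx.trans hz.1.le)))
        fun z hz => hneg z (hx.trans_lt hz.1)
    have h1 : 0 ≤ pohozaev u du (r + 1) := by
      refine le_of_tendsto h.tendsto_pohozaev_atTop ?_
      filter_upwards [eventually_gt_atTop (r + 1)] with x hx
      exact (hlt _ _ (by linarith) hx).le
    exact h1.trans_lt (hlt r (r + 1) le_rfl (by linarith))

variable {u₁ du₁ u₂ du₂ : ℝ → ℝ}

/-- Comparison of two profiles through the ratio `u₂ / u₁` and the Pohozaev functional. -/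
lemma not_lt_apply_zero (h₁ : IsDecayingProfile u₁ du₁) (h₂ : IsDecayingProfile u₂ du₂) :
    ¬ u₂ 0 < u₁ 0 := by
  intro hlt
  set D : ℝ → ℝ := fun r => r ^ 2 * (du₂ r * u₁ r - u₂ r * du₁ r) with hD
  have hDd : ∀ r, 0 < r → HasDerivAt D (r ^ 2 * (u₁ r * u₂ r * (u₁ r - u₂ r))) r := by
    intro r hr
    refine (((hasDerivAt_id r).pow 2).mul (((h₂.hasDerivAt_du r hr).mul (h₁.hasDerivAt r hr)).sub
      ((h₂.hasDerivAt r hr).mul (h₁.hasDerivAt_du r hr)))).congr_deriv ?_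
    simp
    field_simp
    ring
  have hDc : ContinuousOn D (Ici 0) := by
    intro r hr
    rcases eq_or_lt_of_le (mem_Ici.1 hr) with rfl | hr
    · have hD0 : D 0 = 0 := by simp [hD]
      rw [← continuousWithinAt_Ioi_iff_Ici, ContinuousWithinAt, hD0]
      have hid : Tendsto (fun r : ℝ => r) (𝓝[>] 0) (𝓝 0) :=
        tendsto_id.mono_left nhdsWithin_le_nhds
      simpa using (hid.pow 2).mul ((h₂.tendsto_du.mul h₁.tendsto_zero_right).sub
        (h₂.tendsto_zero_right.mul h₁.tendsto_du))
    · exact (hDd r hr).continuousAt.continuousWithinAt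
  set W : ℝ → ℝ := fun r => u₂ r / u₁ r with hW
  have hWd : ∀ r, 0 < r → HasDerivAt W ((du₂ r * u₁ r - u₂ r * du₁ r) / u₁ r ^ 2) r :=
    fun r hr => (h₂.hasDerivAt r hr).div (h₁.hasDerivAt r hr) (h₁.pos r hr.le).ne'
  have hWc : ContinuousOn W (Ici 0) :=
    h₂.continuousOn.div h₁.continuousOn fun r hr => (h₁.pos r hr).ne'
  set X : ℝ → ℝ := fun r => W r ^ 2 * pohozaev u₁ du₁ r - pohozaev u₂ du₂ r with hX
  have hXd : ∀ r, 0 < r → HasDerivAt X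
      (2 * W r * ((du₂ r * u₁ r - u₂ r * du₁ r) / u₁ r ^ 2) * pohozaev u₁ du₁ r) r := by
    intro r hr
    refine ((((hWd r hr).pow 2).mul (h₁.hasDerivAt_pohozaev hr)).sub
      (h₂.hasDerivAt_pohozaev hr)).congr_deriv ?_
    have := (h₁.pos r hr.le).ne'
    simp only [hW]
    simp
    field_simp
    ring
  have hXc : ContinuousOn X (Ici 0) :=
    ((hWc.pow 2).mul h₁.continuousOn_pohozaev).sub h₂.continuousOn_pohozaev
  have hX0 : X 0 = 0 := by simp [hX, pohozaev_zero]
  -- As long as `D > 0`, `X` increases.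
  have hXmono : ∀ a b, 0 ≤ a → a < b → (∀ r ∈ Ioo a b, 0 < D r) → X a < X b := by
    intro a b ha hab hpos
    refine lt_of_hasDerivAt_pos hab (hXc.mono fun z hz => ha.trans hz.1)
      (fun z hz => hXd z (ha.trans_lt hz.1)) fun z hz => ?_
    have hz0 : 0 < z := ha.trans_lt hz.1
    have e1 := h₁.pos z hz0.le
    have e2 := h₂.pos z hz0.le
    have e3 := h₁.pohozaev_pos hz0
    have e4 : 0 < du₂ z * u₁ z - u₂ z * du₁ z :=
      pos_of_mul_pos_right (hpos z hz) (by positivity)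
    simp only [hW]
    positivity
  -- As long as `u₂ < u₁`, `D` increases.
  have hDpos : ∀ b, 0 < b → (∀ r ∈ Ioo 0 b, u₂ r < u₁ r) → 0 < D b := by
    intro b hb hub
    have hD0 : D 0 = 0 := by simp [hD]
    rw [← hD0]
    refine lt_of_hasDerivAt_pos hb (hDc.mono Icc_subset_Ici_self)
      (fun z hz => hDd z hz.1) fun z hz => ?_
    have hz0 : 0 < z := hz.1
    have e1 := h₁.pos z hz0.le
    have e2 := h₂.pos z hz0.le
    have e3 : 0 < u₁ z - u₂ z := by linarith [hub z hz]
    positivity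
  obtain ⟨δ, hδ, hlt'⟩ : ∃ δ > 0, ∀ r ∈ Ico 0 δ, u₂ r < u₁ r := by
    have h3 : ∀ᶠ r in 𝓝[≥] (0 : ℝ), u₂ r < u₁ r :=
      (h₂.continuousOn 0 self_mem_Ici).eventually_lt (h₁.continuousOn 0 self_mem_Ici) hlt
    obtain ⟨δ, hδ, hsub⟩ := (mem_nhdsGE_iff_exists_Ico_subset).1 h3
    exact ⟨δ, hδ, fun r hr => hsub hr⟩
  have hDall : ∀ r, 0 < r → 0 < D r := by
    intro b hb
    rcases lt_or_ge b δ with hbδ | hbδ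
    · exact hDpos b hb fun r hr => hlt' r ⟨hr.1.le, hr.2.trans hbδ⟩
    by_contra hneg
    have hs : 0 < δ / 2 := by positivity
    obtain ⟨c, hc, hc0, hcpos⟩ := exists_first_zero (f := fun r => -D r) (a := δ / 2) (b := b)
      (by linarith) (hDc.neg.mono fun z hz => hs.le.trans hz.1)
      (neg_lt_zero.2 (hDpos _ hs fun r hr => hlt' r ⟨hr.1.le, by linarith [hr.2]⟩))
      (by linarith [not_lt.1 hneg])
    have hcz : 0 < c := hs.trans hc.1
    have hDc0 : D c = 0 := by linarith
    have hposc : ∀ r ∈ Ioo 0 c, 0 < D r := by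
      intro r hr
      rcases lt_or_ge r (δ / 2) with h4 | h4
      · exact hDpos r hr.1 fun s hs => hlt' s ⟨hs.1.le, by linarith [hs.2]⟩
      · linarith [hcpos r ⟨h4, hr.2⟩]
    have hu1c := h₁.pos c hcz.le
    have hWc1 : 1 < W c := by
      by_contra hle
      have hWlt : ∀ r ∈ Ioo 0 c, u₂ r < u₁ r := by
        intro r hr
        have h5 : W r < W c := by
          refine lt_of_hasDerivAt_pos hr.2 (hWc.mono fun z hz => hr.1.le.trans hz.1)
            (fun z hz => hWd z (hr.1.trans hz.1)) fun z hz => ?_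
          have hz0 : 0 < z := hr.1.trans hz.1
          have e1 := h₁.pos z hz0.le
          have e4 : 0 < du₂ z * u₁ z - u₂ z * du₁ z :=
            pos_of_mul_pos_right (hposc z ⟨hz0, hz.2⟩) (by positivity)
          positivity
        exact (div_lt_one (h₁.pos r hr.1.le)).1 (h5.trans_le (not_lt.1 hle))
      exact (hDpos c hcz hWlt).ne' hDc0
    have hXc0 : 0 < X c := by
      rw [← hX0]
      exact hXmono 0 c le_rfl hcz hposc
    have hu2 : u₂ c = W c * u₁ c := by simp only [hW]; field_simp
    have hdu2 : du₂ c = W c * du₁ c := by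
      have h6 : du₂ c * u₁ c - u₂ c * du₁ c = 0 := by
        rcases mul_eq_zero.1 hDc0 with h7 | h7
        · exact absurd h7 (by positivity)
        · exact h7
      have h8 : du₂ c * u₁ c = W c * du₁ c * u₁ c := by rw [hu2] at h6; linarith
      exact mul_right_cancel₀ hu1c.ne' h8
    have hXeq : X c = c ^ (2 / 5 : ℝ) * (c ^ 2 * u₁ c ^ 3 * W c ^ 2 / 3) * (1 - W c) := by
      simp only [hX, pohozaev]
      rw [hu2, hdu2]
      ring
    have h9 := rpow_pos_of_pos hcz (2 / 5)
    have h10 : 0 < W c := by linarith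
    have : X c < 0 := by
      rw [hXeq]
      exact mul_neg_of_pos_of_neg (by positivity) (by linarith)
    linarith
  have hX1 : 0 < X 1 := by
    rw [← hX0]
    exact hXmono 0 1 le_rfl one_pos fun r hr => hDall r hr.1
  have hXlim : Tendsto X atTop (𝓝 (0 - 0)) := by
    refine Tendsto.sub ?_ h₂.tendsto_pohozaev_atTop
    obtain ⟨R, C, hR, hb⟩ := h₁.exists_abs_pohozaev_le
    refine squeeze_zero_norm' ?_ (h₂.tendsto_pow_mul_sq C)
    filter_upwards [eventually_ge_atTop R] with r hr
    have e1 := h₁.pos r (by linarith)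
    rw [Real.norm_eq_abs, abs_mul, abs_of_nonneg (sq_nonneg _)]
    calc W r ^ 2 * |pohozaev u₁ du₁ r| ≤ W r ^ 2 * (C * r ^ 3 * u₁ r ^ 2) := by
          gcongr
          exact hb r hr
      _ = _ := by simp only [hW]; field_simp
  have : X 1 ≤ 0 - 0 := by
    refine ge_of_tendsto hXlim ?_
    filter_upwards [eventually_gt_atTop 1] with r hr
    exact (hXmono 1 r zero_le_one hr fun s hs => hDall s (one_pos.trans hs.1)).le
  linarith

/-- Two profiles coincide. -/
theorem eqOn (h₁ : IsDecayingProfile u₁ du₁) (h₂ : IsDecayingProfile u₂ du₂) :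
    EqOn u₁ u₂ (Ici 0) := by
  have h0 : u₁ 0 = u₂ 0 :=
    le_antisymm (not_lt.1 (h₁.not_lt_apply_zero h₂)) (not_lt.1 (h₂.not_lt_apply_zero h₁))
  intro b hb
  rcases eq_or_lt_of_le (mem_Ici.1 hb) with rfl | hb
  · exact h0
  obtain ⟨M₁, hM₁⟩ := (isCompact_Icc (a := 0) (b := b)).exists_bound_of_continuousOn
    (h₁.continuousOn.mono Icc_subset_Ici_self)
  obtain ⟨M₂, hM₂⟩ := (isCompact_Icc (a := 0) (b := b)).exists_bound_of_continuousOn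
    (h₂.continuousOn.mono Icc_subset_Ici_self)
  set K : ℝ := 2 + |M₁| + |M₂| with hK
  set p : ℝ → ℝ := fun r => r * u₁ r - r * u₂ r with hp
  set q : ℝ → ℝ := fun r => (u₁ r + r * du₁ r) - (u₂ r + r * du₂ r) with hq
  have hexp : ∀ r : ℝ, HasDerivAt (fun r => rexp (-(K * r))) (rexp (-(K * r)) * (-K)) r :=
    fun r => (((hasDerivAt_id r).const_mul K).neg.exp).congr_deriv (by simp)
  set N : ℝ → ℝ := fun r => (p r ^ 2 + q r ^ 2) * rexp (-(K * r)) with hN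
  have hNd : ∀ r, 0 < r → HasDerivAt N
      ((2 * p r * q r * (2 - u₁ r - u₂ r) - K * (p r ^ 2 + q r ^ 2)) * rexp (-(K * r))) r := by
    intro r hr
    have hpd : HasDerivAt p (q r) r := (h₁.hasDerivAt_mul hr).sub (h₂.hasDerivAt_mul hr)
    have hqd : HasDerivAt q (r * (u₁ r - u₁ r ^ 2) - r * (u₂ r - u₂ r ^ 2)) r :=
      (h₁.hasDerivAt_mul_deriv hr).sub (h₂.hasDerivAt_mul_deriv hr)
    refine (((hpd.pow 2).add (hqd.pow 2)).mul (hexp r)).congr_deriv ?_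
    simp only [hp]
    simp
    ring
  have hNc : ContinuousOn N (Icc 0 b) := by
    intro r hr
    rcases eq_or_lt_of_le hr.1 with rfl | hr
    · refine ContinuousWithinAt.mono ?_ Icc_subset_Ici_self
      have hN0 : N 0 = 0 := by simp [hN, hp, hq, h0]
      rw [← continuousWithinAt_Ioi_iff_Ici, ContinuousWithinAt, hN0]
      have hid : Tendsto (fun r : ℝ => r) (𝓝[>] 0) (𝓝 0) :=
        tendsto_id.mono_left nhdsWithin_le_nhds
      have e1 := h₁.tendsto_zero_right
      have e2 := h₂.tendsto_zero_right
      have := ((((hid.mul e1).sub (hid.mul e2)).pow 2).add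
        (((e1.add (hid.mul h₁.tendsto_du)).sub (e2.add (hid.mul h₂.tendsto_du))).pow 2)).mul
        ((hexp 0).continuousAt.tendsto.mono_left (nhdsWithin_le_nhds (s := Ioi 0)))
      simpa [h0] using this
    · exact (hNd r hr).continuousAt.continuousWithinAt
  have hNb : N b ≤ N 0 := by
    refine le_of_hasDerivAt_nonpos hb.le hNc (fun r hr => hNd r hr.1) fun r hr => ?_
    refine mul_nonpos_of_nonpos_of_nonneg ?_ (exp_pos _).le
    have e1 := hM₁ r (Ioo_subset_Icc_self hr)
    have e2 := hM₂ r (Ioo_subset_Icc_self hr)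
    rw [Real.norm_eq_abs] at e1 e2
    have e3 : |2 - u₁ r - u₂ r| ≤ K := by
      rw [hK, abs_le]
      have := abs_le.1 e1
      have := abs_le.1 e2
      constructor <;> linarith [le_abs_self M₁, le_abs_self M₂]
    have e4 : 2 * p r * q r * (2 - u₁ r - u₂ r) ≤ |2 * p r * q r| * |2 - u₁ r - u₂ r| := by
      rw [← abs_mul]; exact le_abs_self _
    have e5 : |2 * p r * q r| ≤ p r ^ 2 + q r ^ 2 := by
      rw [abs_le]
      constructor <;> nlinarith [sq_nonneg (p r - q r), sq_nonneg (p r + q r)]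
    have e6 : |2 * p r * q r| * |2 - u₁ r - u₂ r| ≤ (p r ^ 2 + q r ^ 2) * K := by gcongr
    linarith
  have hN0 : N 0 = 0 := by simp [hN, hp, hq, h0]
  have hpb : p b ^ 2 ≤ 0 := by
    have : (p b ^ 2 + q b ^ 2) * rexp (-(K * b)) ≤ 0 := hNb.trans_eq hN0
    nlinarith [sq_nonneg (q b), exp_pos (-(K * b)), sq_nonneg (p b)]
  have : p b = 0 := by nlinarith [sq_nonneg (p b), pow_eq_zero_iff (two_ne_zero) (a := p b)]
  have h7 : b * (u₁ b - u₂ b) = 0 := by simp only [hp] at this; linarith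
  rcases mul_eq_zero.1 h7 with h8 | h8
  · exact absurd h8 hb.ne'
  · linarith

end IsDecayingProfile

/-! ### Shooting -/

/-- The nonlinearity `x - x ^ 2` with its argument clamped to `[0, M]`. -/
def clampNonlin (M x : ℝ) : ℝ := max 0 (min x M) - max 0 (min x M) ^ 2

/-- The potential whose derivative is `-clampNonlin M`. -/
def clampPotential (M x : ℝ) : ℝ := -∫ y in (0)..x, clampNonlin M y

section clamp

variable {M x : ℝ}

lemma clampNonlin_of_mem (hx : x ∈ Icc 0 M) : clampNonlin M x = x - x ^ 2 := by
  rw [clampNonlin, min_eq_left hx.2, max_eq_right hx.1]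

lemma clampNonlin_of_nonpos (hx : x ≤ 0) : clampNonlin M x = 0 := by
  rw [clampNonlin, max_eq_left ((min_le_left x M).trans hx)]
  ring

lemma clampNonlin_neg (hM : 1 < M) (hx : 1 < x) : clampNonlin M x < 0 := by
  rw [clampNonlin]
  have h1 : 1 < min x M := lt_min hx hM
  rw [max_eq_right (by linarith)]
  nlinarith

lemma continuous_clampNonlin : Continuous (clampNonlin M) := by
  unfold clampNonlin
  fun_prop

lemma abs_clampNonlin_le (hM : 0 ≤ M) : |clampNonlin M x| ≤ M + M ^ 2 := by
  have h0 : 0 ≤ max 0 (min x M) := le_max_left _ _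
  have h1 : max 0 (min x M) ≤ M := max_le hM (min_le_right _ _)
  rw [clampNonlin, abs_le]
  constructor <;> nlinarith

lemma lipschitzWith_clampNonlin (hM : 0 ≤ M) :
    LipschitzWith (1 + 2 * M).toNNReal (clampNonlin M) := by
  refine LipschitzWith.of_dist_le_mul fun x y => ?_
  rw [Real.coe_toNNReal _ (by linarith), Real.dist_eq, Real.dist_eq]
  have hc : ∀ x, max 0 (min x M) ∈ Icc 0 M := fun x =>
    ⟨le_max_left _ _, max_le hM (min_le_right _ _)⟩
  have hd : |max 0 (min x M) - max 0 (min y M)| ≤ |x - y| := by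
    refine (abs_max_sub_max_le_max 0 (min x M) 0 (min y M)).trans ?_
    refine max_le (by simp) ((abs_min_sub_min_le_max x M y M).trans ?_)
    exact max_le le_rfl (by simp)
  have hx := hc x
  have hy := hc y
  unfold clampNonlin
  generalize max 0 (min x M) = s at *
  generalize max 0 (min y M) = t at *
  rw [show s - s ^ 2 - (t - t ^ 2) = (1 - s - t) * (s - t) by ring, abs_mul]
  refine mul_le_mul ?_ hd (abs_nonneg _) (by linarith)
  rw [abs_le]
  constructor <;> linarith [hx.1, hx.2, hy.1, hy.2]

lemma hasDerivAt_clampPotential (x : ℝ) :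
    HasDerivAt (clampPotential M) (-clampNonlin M x) x :=
  (intervalIntegral.integral_hasDerivAt_right
    (continuous_clampNonlin.intervalIntegrable _ _)
    (continuous_clampNonlin.stronglyMeasurableAtFilter _ _)
    continuous_clampNonlin.continuousAt).neg

lemma clampPotential_of_nonpos (hx : x ≤ 0) : clampPotential M x = 0 := by
  rw [clampPotential, intervalIntegral.integral_congr (g := fun _ => 0)]
  · simp
  · intro y hy
    rw [uIcc_of_ge hx] at hy
    exact clampNonlin_of_nonpos hy.2

lemma clampPotential_of_mem (hx : x ∈ Icc 0 M) :
    clampPotential M x = x ^ 3 / 3 - x ^ 2 / 2 := by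
  rw [clampPotential, intervalIntegral.integral_congr (g := fun y => y - y ^ 2)]
  · rw [intervalIntegral.integral_sub (by simp) (by simp)]
    simp
    ring
  · intro y hy
    rw [uIcc_of_le hx.1] at hy
    exact clampNonlin_of_mem ⟨hy.1, hy.2.trans hx.2⟩

lemma clampPotential_lt (hM : 1 < M) {y : ℝ} (hx : 1 ≤ x) (hxy : x < y) :
    clampPotential M x < clampPotential M y := by
  refine lt_of_hasDerivAt_pos hxy (HasDerivAt.continuousOn fun z _ => hasDerivAt_clampPotential z)
    (fun z _ => hasDerivAt_clampPotential z) fun z hz => ?_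
  linarith [clampNonlin_neg hM (hx.trans_lt hz.1)]

end clamp

/-- `u` is the solution of `(r ^ 2 u')' = r ^ 2 clampNonlin M u` with `u 0 = a`, and `P` is its
flux `r ^ 2 u'`. -/
structure IsShot (M a : ℝ) (u P : ℝ → ℝ) : Prop where
  continuousOn : ContinuousOn u (Ici 0)
  apply_zero : u 0 = a
  continuousOn_flux : ContinuousOn P (Ici 0)
  flux_zero : P 0 = 0
  hasDerivAt : ∀ r, 0 < r → HasDerivAt u (P r / r ^ 2) r
  hasDerivAt_flux : ∀ r, 0 < r → HasDerivAt P (r ^ 2 * clampNonlin M (u r)) r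

theorem exists_isShot {M : ℝ} (hM : 0 ≤ M) :
    ∃ u P : ℝ → ℝ → ℝ, (∀ a, IsShot M a (u a) (P a)) ∧
      (∀ r, 0 < r → Continuous fun a => u a r) ∧ ∀ r, 0 < r → Continuous fun a => P a r := by
  obtain ⟨v, w, hv0, hw0, hv, hw, hvc, hwc⟩ :=
    exists_radial_flow (lipschitzWith_clampNonlin hM) (B := (M + M ^ 2).toNNReal)
      (fun x => by rw [Real.coe_toNNReal _ (by positivity)]; exact abs_clampNonlin_le hM)
  have hu : ∀ a r, r ≠ 0 → dslope (v a) 0 r = v a r / r := fun a r hr => by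
    rw [dslope_of_ne _ hr, slope_def_field, hv0]
    simp
  have hud : ∀ a r, 0 < r → HasDerivAt (dslope (v a) 0) ((r * w a r - v a r) / r ^ 2) r := by
    intro a r hr
    have h1 : HasDerivAt (fun r => v a r / r) ((r * w a r - v a r) / r ^ 2) r :=
      ((hv a r).div (hasDerivAt_id r) hr.ne').congr_deriv (by simp; ring)
    refine h1.congr_of_eventuallyEq ?_
    filter_upwards [eventually_ne_nhds hr.ne'] with s hs using hu a s hs
  have hPd : ∀ a r, HasDerivAt (fun r => r * w a r - v a r)
      (r ^ 2 * clampNonlin M (v a r / r)) r := fun a r =>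
    (((hasDerivAt_id r).mul (hw a r)).sub (hv a r)).congr_deriv (by simp; ring)
  refine ⟨fun a => dslope (v a) 0, fun a r => r * w a r - v a r, fun a => ?_, fun r hr => ?_,
    fun r hr => ?_⟩
  · refine ⟨fun r hr => ?_, ?_, HasDerivAt.continuousOn fun r _ => hPd a r, ?_, hud a, ?_⟩
    · rcases eq_or_lt_of_le (mem_Ici.1 hr) with rfl | hr
      · exact (continuousAt_dslope_same.2 (hv a 0).differentiableAt).continuousWithinAt
      · exact (hud a r hr).continuousAt.continuousWithinAt
    · simp [(hv a 0).deriv, hw0]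
    · simp [hv0]
    · intro r hr
      simpa only [hu a r hr.ne'] using hPd a r
  · simp only [hu _ r hr.ne']
    exact (hvc r hr.le).div_const r
  · exact (continuous_const.mul (hwc r hr.le)).sub (hvc r hr.le)

namespace IsShot

variable {M a : ℝ} {u P : ℝ → ℝ}

lemma flux_sub_mul_le (h : IsShot M a u P) {x y c : ℝ} (hx : 0 ≤ x) (hxy : x ≤ y)
    (hc : ∀ r ∈ Ioo x y, clampNonlin M (u r) ≤ c) :
    P y - c * y ^ 3 / 3 ≤ P x - c * x ^ 3 / 3 := by
  refine le_of_hasDerivAt_nonpos (f := fun r => P r - c * r ^ 3 / 3)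
    (f' := fun r => r ^ 2 * clampNonlin M (u r) - c * r ^ 2) hxy
    ((h.continuousOn_flux.mono fun r hr => hx.trans hr.1).sub (by fun_prop)) (fun r hr => ?_)
    fun r hr => ?_
  · exact ((h.hasDerivAt_flux r (hx.trans_lt hr.1)).sub
      (((hasDerivAt_pow 3 r).const_mul c).div_const 3)).congr_deriv (by simp; ring)
  · nlinarith [hc r hr, sq_nonneg r]

lemma le_flux_sub_mul (h : IsShot M a u P) {x y c : ℝ} (hx : 0 ≤ x) (hxy : x ≤ y)
    (hc : ∀ r ∈ Ioo x y, c ≤ clampNonlin M (u r)) :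
    P x - c * x ^ 3 / 3 ≤ P y - c * y ^ 3 / 3 := by
  refine le_of_hasDerivAt_nonneg (f := fun r => P r - c * r ^ 3 / 3)
    (f' := fun r => r ^ 2 * clampNonlin M (u r) - c * r ^ 2) hxy
    ((h.continuousOn_flux.mono fun r hr => hx.trans hr.1).sub (by fun_prop)) (fun r hr => ?_)
    fun r hr => ?_
  · exact ((h.hasDerivAt_flux r (hx.trans_lt hr.1)).sub
      (((hasDerivAt_pow 3 r).const_mul c).div_const 3)).congr_deriv (by simp; ring)
  · nlinarith [hc r hr, sq_nonneg r]

lemma abs_flux_div_le (h : IsShot M a u P) (hM : 0 ≤ M) {r : ℝ} (hr : 0 < r) :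
    |P r / r ^ 2| ≤ (M + M ^ 2) / 3 * r := by
  have h1 := h.flux_sub_mul_le le_rfl hr.le (fun s _ => (abs_le.1 (abs_clampNonlin_le hM)).2)
  have h2 := h.le_flux_sub_mul le_rfl hr.le (fun s _ => (abs_le.1 (abs_clampNonlin_le hM)).1)
  rw [h.flux_zero] at h1 h2
  rw [abs_div, abs_of_pos (pow_pos hr 2), div_le_iff₀ (pow_pos hr 2), abs_le]
  constructor <;> nlinarith

lemma tendsto_flux_div (h : IsShot M a u P) (hM : 0 ≤ M) :
    Tendsto (fun r => P r / r ^ 2) (𝓝[>] 0) (𝓝 0) := by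
  refine squeeze_zero_norm' (a := fun r => (M + M ^ 2) / 3 * r) ?_ ?_
  · filter_upwards [self_mem_nhdsWithin] with r hr using h.abs_flux_div_le hM hr
  · have : Tendsto (fun r : ℝ => (M + M ^ 2) / 3 * r) (𝓝 0) (𝓝 ((M + M ^ 2) / 3 * 0)) :=
      (continuous_const.mul continuous_id).tendsto 0
    rw [mul_zero] at this
    exact this.mono_left nhdsWithin_le_nhds

lemma hasDerivAt_flux_div (h : IsShot M a u P) {r : ℝ} (hr : 0 < r) :
    HasDerivAt (fun r => P r / r ^ 2) (clampNonlin M (u r) - 2 / r * (P r / r ^ 2)) r :=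
  ((h.hasDerivAt_flux r hr).div (hasDerivAt_pow 2 r) (by positivity)).congr_deriv (by
    simp; field_simp)

lemma continuousOn_flux_div (h : IsShot M a u P) (hM : 0 ≤ M) :
    ContinuousOn (fun r => P r / r ^ 2) (Ici 0) := by
  intro r hr
  rcases eq_or_lt_of_le (mem_Ici.1 hr) with rfl | hr
  · have := continuousWithinAt_Ioi_iff_Ici (f := fun r => P r / r ^ 2) (a := (0 : ℝ))
    refine this.1 ?_
    simpa [ContinuousWithinAt] using h.tendsto_flux_div hM
  · exact (h.hasDerivAt_flux_div hr).continuousAt.continuousWithinAt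

end IsShot

/-- The energy of a trajectory of the clamped equation. -/
def shotEnergy (M : ℝ) (u P : ℝ → ℝ) (r : ℝ) : ℝ :=
  (P r / r ^ 2) ^ 2 / 2 + clampPotential M (u r)

namespace IsShot

variable {M a : ℝ} {u P : ℝ → ℝ}

lemma shotEnergy_anti (h : IsShot M a u P) (hM : 0 ≤ M) {x y : ℝ} (hx : 0 ≤ x) (hxy : x ≤ y) :
    shotEnergy M u P y ≤ shotEnergy M u P x := by
  refine le_of_hasDerivAt_nonpos (f := shotEnergy M u P)
    (f' := fun r => -(2 / r * (P r / r ^ 2) ^ 2)) hxy ?_ (fun r hr => ?_) fun r hr => ?_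
  · have hP : Continuous (clampPotential M) :=
      continuous_iff_continuousAt.2 fun x => (hasDerivAt_clampPotential x).continuousAt
    have hs : Icc x y ⊆ Ici 0 := fun r hr => hx.trans hr.1
    exact ((((h.continuousOn_flux_div hM).pow 2).div_const 2).add
      (hP.comp_continuousOn h.continuousOn)).mono hs
  · have hr0 := hx.trans_lt hr.1
    exact ((((h.hasDerivAt_flux_div hr0).pow 2).div_const 2).add
      ((hasDerivAt_clampPotential (u r)).comp r (h.hasDerivAt r hr0))).congr_deriv (by
        simp; ring)
  · have hr0 := hx.trans_lt hr.1
    have : 0 ≤ 2 / r * (P r / r ^ 2) ^ 2 := by positivity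
    linarith

lemma shotEnergy_le (h : IsShot M a u P) (hM : 0 ≤ M) {r : ℝ} (hr : 0 ≤ r) :
    shotEnergy M u P r ≤ clampPotential M a := by
  refine (h.shotEnergy_anti hM le_rfl hr).trans_eq ?_
  simp [shotEnergy, h.apply_zero]

lemma le_apply_zero (h : IsShot M a u P) (hM : 1 < M) (ha : 1 ≤ a) {r : ℝ} (hr : 0 ≤ r) :
    u r ≤ a := by
  by_contra hcon
  have h1 := clampPotential_lt hM ha (not_le.1 hcon)
  have h2 := h.shotEnergy_le (by linarith) hr
  rw [shotEnergy] at h2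
  nlinarith [sq_nonneg (P r / r ^ 2)]

end IsShot

namespace IsShot

variable {M a : ℝ} {u P : ℝ → ℝ}

/-- A trajectory does not increase where its flux is nonpositive. -/
lemma le_of_flux_nonpos (h : IsShot M a u P) {x y : ℝ} (hx : 0 ≤ x) (hxy : x ≤ y)
    (hP : ∀ r ∈ Ioo x y, P r ≤ 0) : u y ≤ u x :=
  le_of_hasDerivAt_nonpos hxy (h.continuousOn.mono fun _ hr => hx.trans hr.1)
    (fun r hr => h.hasDerivAt r (hx.trans_lt hr.1))
    fun r hr => div_nonpos_of_nonpos_of_nonneg (hP r hr) (sq_nonneg r)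

/-- A trajectory does not decrease where its flux is nonnegative. -/
lemma le_of_flux_nonneg (h : IsShot M a u P) {x y : ℝ} (hx : 0 ≤ x) (hxy : x ≤ y)
    (hP : ∀ r ∈ Ioo x y, 0 ≤ P r) : u x ≤ u y :=
  le_of_hasDerivAt_nonneg hxy (h.continuousOn.mono fun _ hr => hx.trans hr.1)
    (fun r hr => h.hasDerivAt r (hx.trans_lt hr.1))
    fun r hr => div_nonneg (hP r hr) (sq_nonneg r)

/-- A trajectory that has crossed zero stays negative. -/
lemma neg_of_crossing (h : IsShot M a u P) {ξ r : ℝ} (hξ : 0 ≤ ξ) (hu : u ξ < 0) (hP : P ξ < 0)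
    (hr : ξ ≤ r) : u r < 0 := by
  by_contra hcon
  obtain ⟨c, hc, hc0, hlt⟩ := exists_first_zero hr
    (h.continuousOn.mono fun _ hs => hξ.trans hs.1) hu (not_lt.1 hcon)
  have := h.le_of_flux_nonpos hξ hc.1.le fun x hx => by
    have := h.flux_sub_mul_le (c := 0) hξ hx.1.le fun s hs =>
      (clampNonlin_of_nonpos (hlt s ⟨hs.1.le, hs.2.trans hx.2⟩).le).le
    linarith
  linarith

/-- The energy of a trajectory that crosses zero is nonnegative. -/
lemma shotEnergy_nonneg_of_crossing (h : IsShot M a u P) (hM : 0 ≤ M) {ξ r : ℝ} (hξ : 0 ≤ ξ)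
    (hu : u ξ < 0) (hP : P ξ < 0) (hr : 0 ≤ r) : 0 ≤ shotEnergy M u P r := by
  refine le_trans ?_ (h.shotEnergy_anti hM hr (le_max_left r ξ))
  rw [shotEnergy, clampPotential_of_nonpos (h.neg_of_crossing hξ hu hP (le_max_right r ξ)).le]
  positivity

/-- A trajectory starting from a positive value that never crosses zero is nonnegative. -/
lemma nonneg_of_not_crossing (h : IsShot M a u P) (ha : 0 ≤ a)
    (hn : ∀ r, 0 < r → u r < 0 → 0 ≤ P r) {r : ℝ} (hr : 0 ≤ r) : 0 ≤ u r := by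
  by_contra hcon
  have hcon := not_le.1 hcon
  obtain ⟨c, hc, hc0, hlt⟩ := exists_first_zero (f := fun x => u (r - x)) hr
    (h.continuousOn.comp (by fun_prop) fun x hx => sub_nonneg.2 hx.2) (by simpa using hcon)
    (by simpa [h.apply_zero] using ha)
  have hrc : 0 ≤ r - c := sub_nonneg.2 hc.2
  have := h.le_of_flux_nonneg hrc (sub_le_self r hc.1.le) fun x hx =>
    hn x (hrc.trans_lt hx.1) (by
      simpa using hlt (r - x) ⟨(sub_pos.2 hx.2).le, by linarith [hx.1]⟩)
  linarith

lemma mem_Icc_of_nonneg (h : IsShot M a u P) (hM : 1 < M) (ha : 1 < a) (haM : a ≤ M)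
    (hu : ∀ r, 0 ≤ r → 0 ≤ u r)
    {r : ℝ} (hr : 0 ≤ r) : u r ∈ Icc 0 M :=
  ⟨hu r hr, (h.le_apply_zero hM ha.le hr).trans haM⟩

lemma pos_of_nonneg (h : IsShot M a u P) (hM : 1 < M) (ha : 1 < a) (haM : a ≤ M)
    (hu : ∀ r, 0 ≤ r → 0 ≤ u r)
    {r : ℝ} (hr : 0 ≤ r) : 0 < u r := by
  rcases eq_or_lt_of_le hr with rfl | hr
  · rw [h.apply_zero]; linarith
  refine lt_of_le_of_ne (hu r hr.le) fun h0 => ?_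
  have hP0 : P r = 0 := by
    have hmin : IsLocalMin u r := by
      filter_upwards [eventually_gt_nhds hr] with s hs
      rw [← h0]
      exact hu s hs.le
    have := hmin.hasDerivAt_eq_zero (h.hasDerivAt r hr)
    rcases div_eq_zero_iff.1 this with h1 | h1
    · exact h1
    · exact absurd h1 (by positivity)
  set z : ℝ → ℝ := fun s => u s + s * (P s / s ^ 2) + s * u s with hz
  have hzd : ∀ s, 0 < s → HasDerivAt z
      (s * (u s - u s ^ 2) + (u s + s * (P s / s ^ 2))) s := by
    intro s hs
    have e1 := h.hasDerivAt s hs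
    have e2 := h.hasDerivAt_flux_div hs
    rw [clampNonlin_of_mem (h.mem_Icc_of_nonneg hM ha haM hu hs.le)] at e2
    refine ((e1.add ((hasDerivAt_id s).mul e2)).add ((hasDerivAt_id s).mul e1)).congr_deriv ?_
    simp
    field_simp
    ring
  have hexpn : ∀ s : ℝ, HasDerivAt (fun s => rexp (-s)) (-rexp (-s)) s := fun s =>
    ((hasDerivAt_neg s).exp).congr_deriv (by ring)
  have hz0 : ∀ s ∈ Ioc 0 r, 0 ≤ z s := by
    intro s hs
    have hd : ∀ x, s ≤ x → HasDerivAt (fun x => z x * rexp (-x))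
        (-(x * u x ^ 2) * rexp (-x)) x := fun x hx =>
      ((hzd x (hs.1.trans_le hx)).mul (hexpn x)).congr_deriv (by simp only [hz]; ring)
    have h2 := le_of_hasDerivAt_nonpos hs.2 (HasDerivAt.continuousOn fun x hx => hd x hx.1)
      (fun x hx => hd x hx.1.le) fun x hx => by
        have : 0 < x := hs.1.trans hx.1
        have : 0 ≤ x * u x ^ 2 * rexp (-x) := by positivity
        linarith
    have h3 : z r = 0 := by simp [hz, ← h0, hP0]
    simp only [h3, zero_mul] at h2
    exact nonneg_of_mul_nonneg_left h2 (exp_pos _)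
  have hle : ∀ s ∈ Ioc 0 r, u s ≤ 0 := by
    intro s hs
    have hd : ∀ x, s ≤ x → HasDerivAt (fun x => x * u x * rexp x) (z x * rexp x) x := fun x hx =>
      (((hasDerivAt_id x).mul (h.hasDerivAt x (hs.1.trans_le hx))).mul
        (Real.hasDerivAt_exp x)).congr_deriv (by simp [hz]; ring)
    have h2 := le_of_hasDerivAt_nonneg hs.2 (HasDerivAt.continuousOn fun x hx => hd x hx.1)
      (fun x hx => hd x hx.1.le) fun x hx =>
        mul_nonneg (hz0 x ⟨hs.1.trans hx.1, hx.2.le⟩) (exp_pos x).le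
    rw [← h0, mul_zero, zero_mul] at h2
    by_contra hcon
    have h3 : 0 < s * u s * rexp s := mul_pos (mul_pos hs.1 (not_le.1 hcon)) (exp_pos s)
    linarith
  have h4 : Tendsto u (𝓝[>] 0) (𝓝 (u 0)) :=
    (h.continuousOn 0 self_mem_Ici).mono_left (nhdsWithin_mono _ Ioi_subset_Ici_self)
  have h5 : u 0 ≤ 0 := le_of_tendsto h4 (by
    filter_upwards [Ioc_mem_nhdsGT hr] with s hs using hle s hs)
  rw [h.apply_zero] at h5
  linarith

lemma flux_neg (h : IsShot M a u P) (hM : 1 < M) (ha : 1 < a) (haM : a ≤ M)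
    (hu : ∀ r, 0 ≤ r → 0 ≤ u r) (hE : ∀ r, 0 < r → 0 ≤ shotEnergy M u P r)
    {r : ℝ} (hr : 0 < r) : P r < 0 := by
  have hmem := fun {r : ℝ} (hr : 0 ≤ r) => h.mem_Icc_of_nonneg hM ha haM hu hr
  obtain ⟨δ, hδ, hδu⟩ : ∃ δ, 0 < δ ∧ ∀ s ∈ Icc 0 δ, 1 < u s := by
    have h1 : ∀ᶠ s in 𝓝[≥] 0, 1 < u s :=
      (h.continuousOn 0 self_mem_Ici).eventually (lt_mem_nhds (by rw [h.apply_zero]; exact ha))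
    obtain ⟨δ, hδ, hs⟩ := (mem_nhdsGE_iff_exists_Icc_subset).1 h1
    exact ⟨δ, hδ, hs⟩
  have hPδ : ∀ s ∈ Ioc 0 δ, P s < 0 := by
    intro s hs
    have := lt_of_hasDerivAt_neg hs.1 (h.continuousOn_flux.mono Icc_subset_Ici_self)
      (fun x hx => h.hasDerivAt_flux x hx.1) fun x hx =>
        mul_neg_of_pos_of_neg (pow_pos hx.1 2)
          (clampNonlin_neg hM (hδu x ⟨hx.1.le, hx.2.le.trans hs.2⟩))
    rwa [h.flux_zero] at this
  by_contra hcon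
  have hδr : δ < r := by
    by_contra h1
    exact hcon (hPδ r ⟨hr, not_lt.1 h1⟩)
  obtain ⟨c, hc, hc0, hlt⟩ := exists_first_zero hδr.le
    (h.continuousOn_flux.mono fun s hs => hδ.le.trans hs.1) (hPδ δ ⟨hδ, le_rfl⟩) (not_lt.1 hcon)
  have hc' : 0 < c := hδ.trans hc.1
  have hneg : ∀ s ∈ Ioo 0 c, P s ≤ 0 := fun s hs => by
    rcases le_or_gt s δ with h1 | h1
    · exact (hPδ s ⟨hs.1, h1⟩).le
    · exact (hlt s ⟨h1.le, hs.2⟩).le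
  have huc : 3 / 2 ≤ u c := by
    have h1 := hE c hc'
    rw [shotEnergy, clampPotential_of_mem (hmem hc'.le), hc0] at h1
    have h2 := h.pos_of_nonneg hM ha haM hu hc'.le
    by_contra h3
    have : u c ^ 2 * (u c - 3 / 2) < 0 :=
      mul_neg_of_pos_of_neg (pow_pos h2 2) (by linarith)
    norm_num at h1
    nlinarith
  have := h.flux_sub_mul_le (c := -(3 / 4)) le_rfl hc'.le fun s hs => by
    have h1 := h.le_of_flux_nonpos hs.1.le hs.2.le fun x hx => hneg x ⟨hs.1.trans hx.1, hx.2⟩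
    rw [clampNonlin_of_mem (hmem hs.1.le)]
    nlinarith
  rw [h.flux_zero, hc0] at this
  have := pow_pos hc' 3
  linarith

lemma anti (h : IsShot M a u P) (hM : 1 < M) (ha : 1 < a) (haM : a ≤ M)
    (hu : ∀ r, 0 ≤ r → 0 ≤ u r) (hE : ∀ r, 0 < r → 0 ≤ shotEnergy M u P r)
    {x y : ℝ} (hx : 0 ≤ x) (hxy : x ≤ y) : u y ≤ u x :=
  h.le_of_flux_nonpos hx hxy fun _ hr => (h.flux_neg hM ha haM hu hE (hx.trans_lt hr.1)).le

lemma exists_lt (h : IsShot M a u P) (hM : 1 < M) (ha : 1 < a) (haM : a ≤ M)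
    (hu : ∀ r, 0 ≤ r → 0 ≤ u r) (hE : ∀ r, 0 < r → 0 ≤ shotEnergy M u P r)
    {ε : ℝ} (hε : 0 < ε) : ∃ r, 0 ≤ r ∧ u r < ε := by
  by_contra! hcon
  have hmem := fun {r : ℝ} (hr : 0 ≤ r) => h.mem_Icc_of_nonneg hM ha haM hu hr
  have hd : ∀ r, 1 ≤ r → P r / r ^ 2 ≤ -min (5 / 48) (ε / 3) := by
    intro r hr
    have hr0 : 0 < r := by linarith
    have hPr := h.flux_neg hM ha haM hu hE hr0
    rcases le_or_gt (5 / 4) (u r) with h1 | h1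
    · have h2 := h.flux_sub_mul_le (c := -(5 / 16)) le_rfl hr0.le fun s hs => by
        have h3 := h.anti hM ha haM hu hE hs.1.le hs.2.le
        rw [clampNonlin_of_mem (hmem hs.1.le)]
        nlinarith
      rw [h.flux_zero] at h2
      have h4 : P r / r ^ 2 ≤ -(5 / 48) := by
        rw [div_le_iff₀ (by positivity)]
        have : r ^ 2 ≤ r ^ 3 := pow_le_pow_right₀ hr (by norm_num)
        linarith
      linarith [min_le_left (5 / 48) (ε / 3)]
    · have h2 := hE r hr0
      rw [shotEnergy, clampPotential_of_mem (hmem hr0.le)] at h2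
      have h3 := hcon r hr0.le
      have h4 : P r / r ^ 2 < 0 := div_neg_of_neg_of_pos hPr (by positivity)
      have h5 : P r / r ^ 2 ≤ -(ε / 3) := by
        by_contra h6
        have h7 : (P r / r ^ 2) ^ 2 ≤ (ε / 3) ^ 2 := by
          nlinarith
        have h8 : ε ^ 2 ≤ u r ^ 2 := pow_le_pow_left₀ hε.le h3 2
        have h9 : u r ^ 2 * (u r - 5 / 4) ≤ 0 :=
          mul_nonpos_of_nonneg_of_nonpos (sq_nonneg _) (by linarith)
        nlinarith [pow_pos hε 2]
      linarith [min_le_right (5 / 48) (ε / 3)]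
  set κ := min (5 / 48) (ε / 3) with hκ
  have hκ0 : 0 < κ := lt_min (by norm_num) (by positivity)
  set r := 1 + (u 1 + 1) / κ with hr
  have hr1 : 1 ≤ r := by
    have := hu 1 zero_le_one
    have : 0 ≤ (u 1 + 1) / κ := by positivity
    linarith
  have hder : ∀ x, 1 ≤ x → HasDerivAt (fun x => u x + κ * x) (P x / x ^ 2 + κ) x := fun x hx =>
    ((h.hasDerivAt x (by linarith)).add ((hasDerivAt_id x).const_mul κ)).congr_deriv (by simp)
  have := le_of_hasDerivAt_nonpos hr1 (HasDerivAt.continuousOn fun x hx => hder x hx.1)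
    (fun x hx => hder x hx.1.le) fun x hx => by linarith [hd x hx.1.le]
  have h2 : κ * r = κ + (u 1 + 1) := by rw [hr]; field_simp
  have h3 := hu r (by linarith)
  simp only [h2] at this
  linarith

/-- A nonnegative trajectory of nonnegative energy is a decaying profile. -/
theorem isDecayingProfile (h : IsShot M a u P) (hM : 1 < M) (ha : 1 < a) (haM : a ≤ M)
    (hu : ∀ r, 0 ≤ r → 0 ≤ u r) (hE : ∀ r, 0 < r → 0 ≤ shotEnergy M u P r) :
    IsDecayingProfile u (fun r => P r / r ^ 2) where
  continuousOn := h.continuousOn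
  tendsto_du := h.tendsto_flux_div (by linarith)
  hasDerivAt := h.hasDerivAt
  hasDerivAt_du r hr := by
    have := h.hasDerivAt_flux_div hr
    rwa [clampNonlin_of_mem (h.mem_Icc_of_nonneg hM ha haM hu hr.le)] at this
  pos r hr := h.pos_of_nonneg hM ha haM hu hr
  tendsto := by
    rw [Metric.tendsto_atTop]
    intro ε hε
    obtain ⟨R, hR, hRu⟩ := h.exists_lt hM ha haM hu hE hε
    refine ⟨R, fun r hr => ?_⟩
    rw [Real.dist_eq, sub_zero, abs_of_nonneg (hu r (hR.trans hr))]
    exact (h.anti hM ha haM hu hE hR hr).trans_lt hRu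

end IsShot

/-- Trajectories starting from a sufficiently large value become negative. -/
lemma IsShot.exists_neg_of_large {s : ℝ} (hs : s = 4 * rexp 2305) {u P : ℝ → ℝ}
    (h : IsShot (s ^ 2) (s ^ 2) u P) : ∃ r, 0 ≤ r ∧ u r < 0 := by
  by_contra! hu
  have hs4 : 4 ≤ s := by
    have := Real.add_one_le_exp 2305
    linarith
  have hs0 : 0 < s := by linarith
  have hs2 : 16 ≤ s ^ 2 := by nlinarith
  have hmem : ∀ {r : ℝ}, 0 ≤ r → u r ∈ Icc 0 (s ^ 2) := fun hr =>
    h.mem_Icc_of_nonneg (by linarith) (by linarith) le_rfl hu hr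
  set l : ℝ := 1 / s with hl
  have hl0 : 0 < l := by positivity
  have hls : s * l = 1 := by rw [hl]; field_simp
  have hl4 : l ≤ 1 / 4 := one_div_le_one_div_of_le (by norm_num) hs4
  have hP1 : ∀ r, 0 ≤ r → -(s ^ 4 * r ^ 3 / 3) ≤ P r := by
    intro r hr
    have := h.le_flux_sub_mul (c := -s ^ 4) le_rfl hr fun x hx => by
      rw [clampNonlin_of_mem (hmem hx.1.le)]
      have := hmem hx.1.le
      nlinarith [this.1, this.2]
    rw [h.flux_zero] at this
    linarith
  have hu1 : ∀ r, 0 ≤ r → s ^ 2 - s ^ 4 * r ^ 2 / 6 ≤ u r := by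
    intro r hr
    have := le_of_hasDerivAt_nonneg (f := fun r => u r + s ^ 4 * r ^ 2 / 6)
      (f' := fun r => P r / r ^ 2 + s ^ 4 * r / 3) hr
      ((h.continuousOn.mono Icc_subset_Ici_self).add (by fun_prop))
      (fun x hx => ((h.hasDerivAt x hx.1).add
        (((hasDerivAt_pow 2 x).const_mul (s ^ 4)).div_const 6)).congr_deriv (by simp; ring))
      fun x hx => by
        have h1 := hP1 x hx.1.le
        have hx0 := hx.1
        have : -(s ^ 4 * x / 3) ≤ P x / x ^ 2 := by
          rw [le_div_iff₀ (by positivity)]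
          linarith
        linarith
    simp only [h.apply_zero] at this
    linarith
  have hPl : P l ≤ -(s / 6) := by
    have := h.flux_sub_mul_le (c := -(s ^ 4 / 2)) le_rfl hl0.le fun x hx => by
      rw [clampNonlin_of_mem (hmem hx.1.le)]
      have h1 := hu1 x hx.1.le
      have h2 := (hmem hx.1.le).2
      have h3 : s ^ 4 * x ^ 2 ≤ s ^ 4 * l ^ 2 := by
        gcongr
        · exact hx.1.le
        · exact hx.2.le
      have h4 : s ^ 4 * l ^ 2 = s ^ 2 := by
        calc s ^ 4 * l ^ 2 = s ^ 2 * (s * l) ^ 2 := by ring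
          _ = s ^ 2 := by rw [hls]; ring
      have h5 : 5 / 6 * s ^ 2 ≤ u x := by linarith
      have h6 : (5 / 6 * s ^ 2) ^ 2 ≤ u x ^ 2 := pow_le_pow_left₀ (by positivity) h5 2
      nlinarith
    rw [h.flux_zero] at this
    have h4 : s ^ 4 * l ^ 3 = s := by
      calc s ^ 4 * l ^ 3 = s * (s * l) ^ 3 := by ring
        _ = s := by rw [hls]; ring
    linarith
  have hP2 : ∀ r, l ≤ r → r ≤ 1 → P r ≤ -(s / 12) := by
    intro r hr hr1
    have := h.flux_sub_mul_le (c := 1 / 2) hl0.le hr fun x hx => by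
      rw [clampNonlin_of_mem (hmem (hl0.le.trans hx.1.le))]
      nlinarith [sq_nonneg (u x - 1 / 2)]
    have h1 : r ^ 3 ≤ 1 := pow_le_one₀ (hl0.le.trans hr) hr1
    have h2 : 0 < l ^ 3 := by positivity
    linarith
  have hu2 : ∀ r, l ≤ r → r ≤ 1 / 2 → s / (24 * r) ≤ u r := by
    intro r hr hr2
    have hr0 := hl0.trans_le hr
    have hd : ∀ x, l ≤ x → HasDerivAt (fun x => u x - s / 12 * x⁻¹)
        (P x / x ^ 2 + s / 12 * (x ^ 2)⁻¹) x := fun x hx =>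
      ((h.hasDerivAt x (hl0.trans_le hx)).sub
        ((hasDerivAt_inv (hl0.trans_le hx).ne').const_mul _)).congr_deriv (by ring)
    have := le_of_hasDerivAt_nonpos (by linarith : r ≤ 1)
      (HasDerivAt.continuousOn fun x hx => hd x (hr.trans hx.1))
      (fun x hx => hd x (hr.trans hx.1.le)) fun x hx => by
        have h1 := hP2 x (hr.trans hx.1.le) hx.2.le
        rw [div_eq_mul_inv, ← add_mul]
        exact mul_nonpos_of_nonpos_of_nonneg (by linarith) (by positivity)
    have h2 := hu 1 zero_le_one
    have h3 : 2 ≤ r⁻¹ := by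
      rw [le_inv_comm₀ (by norm_num) hr0]
      linarith
    have h4 : s / (24 * r) = s / 24 * r⁻¹ := by field_simp
    rw [h4]
    simp only [inv_one] at this
    nlinarith
  have hP3 : ∀ r, l ≤ r → r ≤ 1 / 2 → P r ≤ -(s ^ 2 / 1152 * (r - l)) := by
    intro r hr hr2
    have hd : ∀ x, l ≤ x → HasDerivAt (fun x => P x - x ^ 3 / 6 + s ^ 2 / 1152 * x)
        (x ^ 2 * (u x - u x ^ 2) - x ^ 2 / 2 + s ^ 2 / 1152) x := fun x hx => by
      have h1 := h.hasDerivAt_flux x (hl0.trans_le hx)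
      rw [clampNonlin_of_mem (hmem (hl0.le.trans hx))] at h1
      exact ((h1.sub ((hasDerivAt_pow 3 x).div_const 6)).add
        ((hasDerivAt_id x).const_mul _)).congr_deriv (by simp; ring)
    have := le_of_hasDerivAt_nonpos hr
      (HasDerivAt.continuousOn fun x hx => hd x hx.1)
      (fun x hx => hd x hx.1.le) fun x hx => by
        have hx0 := hl0.trans hx.1
        have h1 := hu2 x hx.1.le (hx.2.le.trans hr2)
        rw [div_le_iff₀ (by positivity)] at h1
        have h2 : s ^ 2 ≤ (u x * (24 * x)) ^ 2 := pow_le_pow_left₀ hs0.le h1 2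
        have h3 : 0 ≤ x ^ 2 * (u x - 1) ^ 2 := by positivity
        nlinarith
    have h1 : r ^ 3 ≤ 1 := pow_le_one₀ (hl0.le.trans hr) (by linarith)
    have h2 : 0 < l ^ 3 := by positivity
    linarith
  have hl2 : 2 * l ≤ 1 / 2 := by linarith
  have hd : ∀ x, 2 * l ≤ x → HasDerivAt (fun x => u x + s ^ 2 / 2304 * Real.log x)
      (P x / x ^ 2 + s ^ 2 / 2304 * x⁻¹) x := fun x hx =>
    (h.hasDerivAt x (by linarith)).add ((Real.hasDerivAt_log (by linarith)).const_mul _)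
  have hfin := le_of_hasDerivAt_nonpos hl2
    (HasDerivAt.continuousOn fun x hx => hd x hx.1)
    (fun x hx => hd x hx.1.le) fun x hx => by
      have hx0 : 0 < x := by linarith [hx.1]
      have h1 := hP3 x (by linarith [hx.1]) hx.2.le
      have h2 : P x / x ^ 2 ≤ -(s ^ 2 / 2304 * x⁻¹) := by
        rw [div_le_iff₀ (by positivity)]
        have h3 : s ^ 2 / 2304 * x⁻¹ * x ^ 2 = s ^ 2 / 2304 * x := by field_simp
        rw [neg_mul, h3]
        nlinarith [hx.1]
      linarith
  have h1 := hu (1 / 2) (by norm_num)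
  have h2 := (hmem (r := 2 * l) (by positivity)).2
  have h3 : Real.log (1 / 2) - Real.log (2 * l) = 2305 := by
    rw [← Real.log_div (by norm_num) (by positivity)]
    have : 1 / 2 / (2 * l) = rexp 2305 := by
      rw [hl, hs]
      field_simp
      norm_num
    rw [this, Real.log_exp]
  nlinarith

/-- The radial equation has a positive decaying solution. -/
theorem exists_isDecayingProfile : ∃ u du : ℝ → ℝ, IsDecayingProfile u du := by
  set s : ℝ := 4 * rexp 2305 with hs
  have hs4 : 4 ≤ s := by
    have := Real.add_one_le_exp 2305
    linarith
  have hs2 : 16 ≤ s ^ 2 := by nlinarith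
  obtain ⟨u, P, h, huc, hPc⟩ := exists_isShot (M := s ^ 2) (by positivity)
  set U : Set ℝ := {a | ∃ r, 0 < r ∧ shotEnergy (s ^ 2) (u a) (P a) r < 0} with hU
  set V : Set ℝ := {a | ∃ r, 0 < r ∧ u a r < 0 ∧ P a r < 0} with hV
  have hUo : IsOpen U := by
    have : U = ⋃ r ∈ Ioi (0 : ℝ), {a | shotEnergy (s ^ 2) (u a) (P a) r < 0} := by
      ext a; simp [hU]
    rw [this]
    refine isOpen_biUnion fun r hr => isOpen_lt ?_ continuous_const
    have hΦ : Continuous (clampPotential (s ^ 2)) :=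
      continuous_iff_continuousAt.2 fun x => (hasDerivAt_clampPotential x).continuousAt
    exact ((((hPc r hr).div_const _).pow 2).div_const 2).add (hΦ.comp (huc r hr))
  have hVo : IsOpen V := by
    have : V = ⋃ r ∈ Ioi (0 : ℝ), ({a | u a r < 0} ∩ {a | P a r < 0}) := by
      ext a; simp [hV, and_left_comm]
    rw [this]
    exact isOpen_biUnion fun r hr => (isOpen_lt (huc r hr) continuous_const).inter
      (isOpen_lt (hPc r hr) continuous_const)
  have hU1 : (5 / 4 : ℝ) ∈ U := by
    refine ⟨1, one_pos, ((h _).shotEnergy_le (by positivity) zero_le_one).trans_lt ?_⟩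
    rw [clampPotential_of_mem ⟨by norm_num, by linarith⟩]
    norm_num
  have hV1 : s ^ 2 ∈ V := by
    by_contra hcon
    obtain ⟨r, hr, hur⟩ := (h (s ^ 2)).exists_neg_of_large hs
    refine absurd hur (not_lt.2 ?_)
    refine (h (s ^ 2)).nonneg_of_not_crossing (by positivity) (fun x hx hux => ?_) hr
    by_contra hP
    exact hcon ⟨x, hx, hux, not_le.1 hP⟩
  have hdisj : U ∩ V = ∅ := by
    ext a
    simp only [mem_inter_iff, mem_empty_iff_false, iff_false, not_and]
    rintro ⟨r, hr, hE⟩ ⟨ξ, hξ, hu, hP⟩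
    exact absurd ((h a).shotEnergy_nonneg_of_crossing (by positivity) hξ.le hu hP hr.le)
      (not_le.2 hE)
  obtain ⟨a, ha, haU, haV⟩ : ∃ a ∈ Icc (5 / 4) (s ^ 2), a ∉ U ∧ a ∉ V := by
    by_contra! hcon
    obtain ⟨x, hx⟩ := isPreconnected_Icc (a := (5 / 4 : ℝ)) (b := s ^ 2) U V hUo hVo
      (fun a ha => (em (a ∈ U)).imp id (hcon a ha))
      ⟨5 / 4, left_mem_Icc.2 (by linarith), hU1⟩ ⟨s ^ 2, right_mem_Icc.2 (by linarith), hV1⟩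
    rw [hdisj] at hx
    exact hx.2
  have hu : ∀ r, 0 ≤ r → 0 ≤ u a r := fun r hr =>
    (h a).nonneg_of_not_crossing (by linarith [ha.1]) (fun x hx hux => by
      by_contra hP
      exact haV ⟨x, hx, hux, not_le.1 hP⟩) hr
  exact ⟨u a, _, (h a).isDecayingProfile (by linarith) (by linarith [ha.1]) ha.2 hu
    fun r hr => not_lt.1 fun hE => haU ⟨r, hr, hE⟩⟩

/-! ### Smoothness of weighted averages along rays -/

section RayAverage

lemma hasFDerivAt_rayAverage {E H : Type*} [NormedAddCommGroup E] [NormedSpace ℝ E]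
    [FiniteDimensional ℝ E] [NormedAddCommGroup H] [NormedSpace ℝ H] {φ : ℝ → ℝ} (hφ : Continuous φ)
    {f : E → H} {f' : E → E →L[ℝ] H} (hf : ∀ p, HasFDerivAt f (f' p) p) (hf' : Continuous f')
    (p : E) :
    HasFDerivAt (fun p => ∫ θ in (0 : ℝ)..1, φ θ • f (θ • p))
      (∫ θ in (0 : ℝ)..1, (φ θ * θ) • f' (θ • p)) p := by
  have hfc : Continuous f := continuous_iff_continuousAt.2 fun p => (hf p).continuousAt
  have hproper : ProperSpace E := FiniteDimensional.proper_real E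
  obtain ⟨C, hC⟩ := (isCompact_closedBall (0 : E) (‖p‖ + 1)).exists_bound_of_continuousOn
    hf'.continuousOn
  have h1 : ∀ p : E, Continuous fun θ : ℝ => φ θ • f (θ • p) := fun p => by fun_prop
  have h2 : Continuous fun θ : ℝ => (φ θ * θ) • f' (θ • p) := by fun_prop
  refine intervalIntegral.hasFDerivAt_integral_of_dominated_of_fderiv_le
    (F' := fun p θ => (φ θ * θ) • f' (θ • p)) (bound := fun θ => |φ θ * θ| * C)
    (Metric.ball_mem_nhds p one_pos) (Eventually.of_forall fun q => (h1 q).aestronglyMeasurable)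
    ((h1 p).intervalIntegrable _ _) h2.aestronglyMeasurable ?_
    (Continuous.intervalIntegrable (by fun_prop) _ _) ?_
  · refine Eventually.of_forall fun θ hθ q hq => ?_
    rw [norm_smul, Real.norm_eq_abs]
    refine mul_le_mul_of_nonneg_left (hC _ ?_) (abs_nonneg _)
    rw [uIoc_of_le zero_le_one] at hθ
    rw [mem_closedBall_zero_iff, norm_smul, Real.norm_eq_abs, abs_of_pos hθ.1]
    have h3 : ‖q‖ ≤ ‖p‖ + 1 := by
      have := norm_le_norm_add_norm_sub' q p
      rw [← dist_eq_norm] at this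
      linarith [Metric.mem_ball.1 hq]
    calc θ * ‖q‖ ≤ 1 * (‖p‖ + 1) := by
          gcongr
          exact hθ.2
      _ = _ := one_mul _
  · refine Eventually.of_forall fun θ _ q _ => ?_
    have h3 : HasFDerivAt (fun q : E => θ • q) (θ • ContinuousLinearMap.id ℝ E) q :=
      (hasFDerivAt_id q).const_smul θ
    refine (((hf (θ • q)).comp q h3).const_smul (φ θ)).congr_fderiv ?_
    ext w
    simp [smul_smul]

lemma contDiff_rayAverage.{u} {E H : Type u} [NormedAddCommGroup E] [NormedSpace ℝ E]
    [FiniteDimensional ℝ E] [NormedAddCommGroup H] [NormedSpace ℝ H] {φ : ℝ → ℝ} (hφ : Continuous φ)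
    {n : ℕ} {f : E → H} (hf : ContDiff ℝ n f) :
    ContDiff ℝ n (fun p => ∫ θ in (0 : ℝ)..1, φ θ • f (θ • p)) := by
  induction n generalizing φ H with
  | zero =>
    have hfc := hf.continuous
    refine contDiff_zero.2 ?_
    exact intervalIntegral.continuous_parametric_intervalIntegral_of_continuous' (by fun_prop) 0 1
  | succ n ih =>
    push_cast at hf ⊢
    obtain ⟨f', hf', hd⟩ := contDiff_succ_iff_hasFDerivAt.1 hf
    exact contDiff_succ_iff_hasFDerivAt.2
      ⟨_, ih (hφ.mul continuous_id) hf', hasFDerivAt_rayAverage hφ hd hf'.continuous⟩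

end RayAverage

/-! ### From the profile to the solution -/

/-- The radial function with profile `u`. -/
def radialExtension {E : Type*} [Norm E] (u : ℝ → ℝ) (p : E) : ℝ := u ‖p‖

/-- The factor `K` in the formula `∇ Q p = K p • p` for a radial solution `Q`. -/
def gradFactor {E : Type*} [NormedAddCommGroup E] [NormedSpace ℝ E] (u : ℝ → ℝ) (p : E) : ℝ :=
  ∫ θ in (0 : ℝ)..1, θ ^ 2 • (radialExtension u (θ • p) - radialExtension u (θ • p) ^ 2)

namespace IsDecayingProfile

variable {u du : ℝ → ℝ}

lemma continuous_radialExtension {E : Type*} [NormedAddCommGroup E] (h : IsDecayingProfile u du) :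
    Continuous (radialExtension u : E → ℝ) :=
  h.continuousOn.comp_continuous continuous_norm fun p => norm_nonneg p

lemma eq_mul_integral (h : IsDecayingProfile u du) {r : ℝ} (hr : 0 < r) :
    du r = r * ∫ θ in (0 : ℝ)..1, θ ^ 2 * (u (θ * r) - u (θ * r) ^ 2) := by
  have hcu : ContinuousOn (fun θ => u (θ * r)) (Icc 0 1) :=
    h.continuousOn.comp (by fun_prop) fun θ hθ => mul_nonneg hθ.1 hr.le
  have := intervalIntegral.integral_eq_sub_of_hasDerivAt_of_le (a := 0) (b := 1)
    (f := fun θ => θ ^ 2 * du (θ * r))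
    (f' := fun θ => r * (θ ^ 2 * (u (θ * r) - u (θ * r) ^ 2))) zero_le_one ?_ ?_ ?_
  · rw [intervalIntegral.integral_const_mul] at this
    rw [this]
    simp
  · intro θ hθ
    rcases eq_or_lt_of_le hθ.1 with rfl | h0
    · have h1 : Tendsto (fun θ : ℝ => θ ^ 2 * du (θ * r)) (𝓝[>] 0) (𝓝 (0 * 0)) := by
        refine Tendsto.mul ?_ (h.tendsto_du.comp ?_)
        · have : Tendsto (fun θ : ℝ => θ ^ 2) (𝓝 0) (𝓝 (0 ^ 2)) := (continuous_pow 2).tendsto 0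
          rw [zero_pow two_ne_zero] at this
          exact this.mono_left nhdsWithin_le_nhds
        · refine tendsto_nhdsWithin_iff.2 ⟨?_, ?_⟩
          · have : Tendsto (fun θ : ℝ => θ * r) (𝓝 0) (𝓝 (0 * r)) :=
              (continuous_mul_const r).tendsto 0
            rw [zero_mul] at this
            exact this.mono_left nhdsWithin_le_nhds
          · filter_upwards [self_mem_nhdsWithin] with θ hθ using mul_pos hθ hr
      refine ContinuousWithinAt.mono ?_ Icc_subset_Ici_self
      refine continuousWithinAt_Ioi_iff_Ici.1 ?_
      simpa [ContinuousWithinAt] using h1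
    · exact ((continuous_pow 2).continuousAt.mul
        (((h.hasDerivAt_du _ (mul_pos h0 hr)).continuousAt).comp
          (f := fun θ : ℝ => θ * r) (by fun_prop))).continuousWithinAt
  · intro θ hθ
    have h1 := (h.hasDerivAt_du _ (mul_pos hθ.1 hr)).comp θ ((hasDerivAt_id θ).mul_const r)
    refine ((hasDerivAt_pow 2 θ).mul h1).congr_deriv ?_
    have := hθ.1
    simp
    field_simp
    ring
  · refine ContinuousOn.intervalIntegrable ?_
    rw [uIcc_of_le zero_le_one]
    exact continuousOn_const.mul ((continuousOn_pow 2).mul (hcu.sub (hcu.pow 2)))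

variable {E : Type*} [NormedAddCommGroup E] [InnerProductSpace ℝ E]

lemma gradFactor_eq (h : IsDecayingProfile u du) {p : E} (hp : p ≠ 0) :
    gradFactor u p = du ‖p‖ / ‖p‖ := by
  have hp' := norm_pos_iff.2 hp
  rw [eq_div_iff hp'.ne', h.eq_mul_integral hp', mul_comm, gradFactor]
  congr 1
  refine intervalIntegral.integral_congr fun θ hθ => ?_
  rw [uIcc_of_le zero_le_one] at hθ
  simp [radialExtension, norm_smul, abs_of_nonneg hθ.1]

lemma hasFDerivAt_radialExtension (h : IsDecayingProfile u du) (p : E) :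
    HasFDerivAt (radialExtension u) (gradFactor u p • innerSL ℝ p) p := by
  rcases eq_or_ne p 0 with rfl | hp
  · have h1 : HasDerivWithinAt u 0 (Ici 0) 0 := by
      refine hasDerivWithinAt_Ici_of_tendsto_deriv (s := Ioi 0)
        (fun r hr => (h.hasDerivAt r hr).differentiableAt.differentiableWithinAt)
        ((h.continuousOn 0 self_mem_Ici).mono Ioi_subset_Ici_self) self_mem_nhdsWithin ?_
      refine h.tendsto_du.congr' ?_
      filter_upwards [self_mem_nhdsWithin] with r hr using (h.hasDerivAt r hr).deriv.symm
    have h2 := h1.isLittleO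
    have h3 : Tendsto (fun p : E => ‖p‖) (𝓝 0) (𝓝[≥] 0) :=
      tendsto_nhdsWithin_iff.2 ⟨tendsto_norm_zero, Eventually.of_forall fun p => norm_nonneg p⟩
    refine HasFDerivAt.of_isLittleO ?_
    refine Asymptotics.IsLittleO.of_norm_right ?_
    simpa [Function.comp_def, radialExtension] using h2.comp_tendsto h3
  · have hp' := norm_pos_iff.2 hp
    have h1 : HasFDerivAt (fun p : E => ‖p‖) ((1 / ‖p‖) • innerSL ℝ p) p := by
      have h2 := (hasStrictFDerivAt_norm_sq p).hasFDerivAt.sqrt (by positivity)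
      simp only [Real.sqrt_sq (norm_nonneg _)] at h2
      refine h2.congr_fderiv ?_
      ext w
      simp
      field_simp
    refine ((h.hasDerivAt _ hp').comp_hasFDerivAt p h1).congr_fderiv ?_
    rw [h.gradFactor_eq hp, smul_smul]
    congr 1
    ring

end IsDecayingProfile

namespace IsDecayingProfile

variable {u du : ℝ → ℝ} {E : Type} [NormedAddCommGroup E] [InnerProductSpace ℝ E]
  [FiniteDimensional ℝ E]

lemma contDiff_gradFactor_of_contDiff {n : ℕ} (hn : ContDiff ℝ n (radialExtension u : E → ℝ)) :
    ContDiff ℝ n (gradFactor u : E → ℝ) :=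
  contDiff_rayAverage (continuous_pow 2) (hn.sub (hn.pow 2))

lemma contDiff_nat (h : IsDecayingProfile u du) (n : ℕ) :
    ContDiff ℝ n (radialExtension u : E → ℝ) := by
  induction n with
  | zero => exact contDiff_zero.2 h.continuous_radialExtension
  | succ n ih =>
    push_cast
    exact contDiff_succ_iff_hasFDerivAt.2 ⟨_,
      (contDiff_gradFactor_of_contDiff ih).smul (innerSL ℝ).contDiff,
      h.hasFDerivAt_radialExtension⟩

/-- The radial function with a decaying profile is smooth. -/
lemma contDiff_radialExtension (h : IsDecayingProfile u du) :
    ContDiff ℝ (⊤ : ℕ∞) (radialExtension u : E → ℝ) :=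
  contDiff_infty.2 h.contDiff_nat

lemma differentiable_gradFactor (h : IsDecayingProfile u du) :
    Differentiable ℝ (gradFactor u : E → ℝ) :=
  (contDiff_gradFactor_of_contDiff (h.contDiff_nat 1)).differentiable one_ne_zero

/-- The derivative of `gradFactor` along rays. -/
lemma fderiv_gradFactor_self (h : IsDecayingProfile u du) (p : E) :
    fderiv ℝ (gradFactor u) p p =
      radialExtension u p - radialExtension u p ^ 2 - 3 * gradFactor u p := by
  set f : E → ℝ := fun p => radialExtension u p - radialExtension u p ^ 2 with hf
  have hfs : ContDiff ℝ 1 f := (h.contDiff_nat 1).sub ((h.contDiff_nat 1).pow 2)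
  have hfd : ∀ p, HasFDerivAt f (fderiv ℝ f p) p := fun p =>
    (hfs.differentiable one_ne_zero p).hasFDerivAt
  have hfc : Continuous (fderiv ℝ f) := hfs.continuous_fderiv one_ne_zero
  have hfc0 := hfs.continuous
  have hK := (hasFDerivAt_rayAverage (continuous_pow 2) hfd hfc p).fderiv
  have hint : Continuous fun θ : ℝ => (θ ^ 2 * θ) • fderiv ℝ f (θ • p) := by fun_prop
  change fderiv ℝ (fun p => ∫ θ in (0 : ℝ)..1, θ ^ 2 • f (θ • p)) p p =
    f p - 3 * ∫ θ in (0 : ℝ)..1, θ ^ 2 • f (θ • p)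
  rw [hK, ContinuousLinearMap.intervalIntegral_apply (hint.intervalIntegrable _ _)]
  have hd : ∀ θ : ℝ, HasDerivAt (fun θ : ℝ => θ ^ 3 * f (θ • p))
      (3 * (θ ^ 2 • f (θ • p)) + ((θ ^ 2 * θ) • fderiv ℝ f (θ • p)) p) θ := by
    intro θ
    have h1 : HasDerivAt (fun θ : ℝ => θ • p) p θ := by
      simpa using (hasDerivAt_id θ).smul_const p
    refine ((hasDerivAt_pow 3 θ).mul ((hfd (θ • p)).comp_hasDerivAt θ h1)).congr_deriv ?_
    simp
    ring
  have h2 := intervalIntegral.integral_eq_sub_of_hasDerivAt (a := 0) (b := 1)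
    (fun θ _ => hd θ) (Continuous.intervalIntegrable (by fun_prop) _ _)
  rw [intervalIntegral.integral_add (Continuous.intervalIntegrable (by fun_prop) _ _)
    (Continuous.intervalIntegrable (by fun_prop) _ _),
    intervalIntegral.integral_const_mul] at h2
  simp only [one_pow, one_smul, one_mul, ne_eq, OfNat.ofNat_ne_zero, not_false_eq_true, zero_pow,
    zero_mul, sub_zero] at h2
  linarith

end IsDecayingProfile

/-! ### Functions of exponential decay on `ℝ³` -/

lemma norm_le_sqrt_sum_sq (p : ℝ × ℝ × ℝ) :
    ‖p‖ ≤ √(p.1 ^ 2 + p.2.1 ^ 2 + p.2.2 ^ 2) := by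
  simp only [Prod.norm_def, Real.norm_eq_abs]
  refine max_le ?_ (max_le ?_ ?_) <;>
  · refine Real.abs_le_sqrt ?_
    nlinarith [sq_nonneg p.1, sq_nonneg p.2.1, sq_nonneg p.2.2]

lemma tendsto_sqrt_sum_sq_cocompact :
    Tendsto (fun p : ℝ × ℝ × ℝ => √(p.1 ^ 2 + p.2.1 ^ 2 + p.2.2 ^ 2)) (cocompact _) atTop :=
  tendsto_atTop_mono norm_le_sqrt_sum_sq (tendsto_norm_cocompact_atTop (E := ℝ × ℝ × ℝ))

lemma integrable_of_le_exp {f : ℝ × ℝ × ℝ → ℝ} (hf : Continuous f) {R C : ℝ}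
    (hb : ∀ p : ℝ × ℝ × ℝ, R ≤ √(p.1 ^ 2 + p.2.1 ^ 2 + p.2.2 ^ 2) →
      |f p| ≤ C * rexp (-√(p.1 ^ 2 + p.2.1 ^ 2 + p.2.2 ^ 2))) : Integrable f := by
  have h₂ : (volume : Measure (ℝ × ℝ)).IsAddHaarMeasure :=
    Measure.prod.instIsAddHaarMeasure volume volume
  have h₃ : (volume : Measure (ℝ × ℝ × ℝ)).IsAddHaarMeasure :=
    Measure.prod.instIsAddHaarMeasure volume volume
  have hg : Integrable (fun p : ℝ × ℝ × ℝ => (1 + ‖p‖) ^ (-(4 : ℝ))) :=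
    integrable_one_add_norm (by simp; norm_num)
  refine hf.locallyIntegrable.integrable_of_isBigO_cocompact ?_ (hg.integrableAtFilter _)
  refine Asymptotics.IsBigO.of_bound (|C| * (24 * rexp 1)) ?_
  filter_upwards [tendsto_sqrt_sum_sq_cocompact.eventually (eventually_ge_atTop R)] with p hp
  have hn := norm_nonneg p
  have h1 : rexp (-√(p.1 ^ 2 + p.2.1 ^ 2 + p.2.2 ^ 2)) ≤ rexp (-‖p‖) :=
    Real.exp_le_exp.2 (neg_le_neg (norm_le_sqrt_sum_sq p))
  have h2 : rexp (-‖p‖) ≤ 24 * rexp 1 * (1 + ‖p‖) ^ (-(4 : ℝ)) := by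
    have h3 := Real.pow_div_factorial_le_exp (1 + ‖p‖) (by positivity) 4
    rw [Real.rpow_neg (by positivity), ← div_eq_mul_inv, le_div_iff₀ (by positivity)]
    have h4 : (1 + ‖p‖) ^ (4 : ℝ) = (1 + ‖p‖) ^ 4 := by exact_mod_cast Real.rpow_natCast _ 4
    rw [h4, Real.exp_neg, inv_mul_le_iff₀ (exp_pos _)]
    rw [Real.exp_add] at h3
    norm_num [Nat.factorial] at h3
    linarith
  calc ‖f p‖ ≤ C * rexp (-√(p.1 ^ 2 + p.2.1 ^ 2 + p.2.2 ^ 2)) := hb p hp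
    _ ≤ |C| * (24 * rexp 1 * (1 + ‖p‖) ^ (-(4 : ℝ))) := by
        gcongr
        · exact le_abs_self C
        · exact h1.trans h2
    _ = _ := by
        rw [Real.norm_of_nonneg (by positivity)]
        ring

/-! ### The ground state with a given profile -/

lemma norm_vec3 (x y z : ℝ) : ‖!₂[x, y, z]‖ = √(x ^ 2 + y ^ 2 + z ^ 2) := by
  simp [EuclideanSpace.norm_eq, Fin.sum_univ_three]

lemma contDiff_vec3 : ContDiff ℝ (⊤ : ℕ∞) (fun p : ℝ × ℝ × ℝ => !₂[p.1, p.2.1, p.2.2]) := by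
  refine contDiff_euclidean.2 fun i => ?_
  fin_cases i <;> simp <;> fun_prop

lemma hasDerivAt_vec3_fst (x y z : ℝ) :
    HasDerivAt (fun a : ℝ => !₂[a, y, z]) !₂[1, 0, 0] x := by
  have h : (fun a : ℝ => !₂[a, y, z]) = fun a : ℝ => a • !₂[1, 0, 0] + !₂[0, y, z] := by
    ext a i
    fin_cases i <;> simp
  rw [h]
  simpa using ((hasDerivAt_id x).smul_const !₂[(1 : ℝ), 0, 0]).add_const !₂[0, y, z]

lemma hasDerivAt_vec3_snd (x y z : ℝ) :
    HasDerivAt (fun a : ℝ => !₂[x, a, z]) !₂[0, 1, 0] y := by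
  have h : (fun a : ℝ => !₂[x, a, z]) = fun a : ℝ => a • !₂[0, 1, 0] + !₂[x, 0, z] := by
    ext a i
    fin_cases i <;> simp
  rw [h]
  simpa using ((hasDerivAt_id y).smul_const !₂[(0 : ℝ), 1, 0]).add_const !₂[x, 0, z]

lemma hasDerivAt_vec3_trd (x y z : ℝ) :
    HasDerivAt (fun a : ℝ => !₂[x, y, a]) !₂[0, 0, 1] z := by
  have h : (fun a : ℝ => !₂[x, y, a]) = fun a : ℝ => a • !₂[0, 0, 1] + !₂[x, y, 0] := by
    ext a i
    fin_cases i <;> simp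
  rw [h]
  simpa using ((hasDerivAt_id z).smul_const !₂[(0 : ℝ), 0, 1]).add_const !₂[x, y, 0]

namespace IsDecayingProfile

variable {u du : ℝ → ℝ}

/-- A decaying profile gives a ground state. -/
theorem isGroundState (h : IsDecayingProfile u du) :
    IsGroundState fun x y z => u (√(x ^ 2 + y ^ 2 + z ^ 2)) := by
  have hQ : ∀ x y z : ℝ, u (√(x ^ 2 + y ^ 2 + z ^ 2)) = radialExtension u !₂[x, y, z] := by
    intro x y z
    rw [radialExtension, norm_vec3]
  simp only [hQ]
  set F : EuclideanSpace ℝ (Fin 3) → ℝ := radialExtension u with hF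
  set K : EuclideanSpace ℝ (Fin 3) → ℝ := gradFactor u with hK
  have hFd : ∀ p, HasFDerivAt F (K p • innerSL ℝ p) p := h.hasFDerivAt_radialExtension
  have hKd : ∀ p, HasFDerivAt K (fderiv ℝ K p) p := fun p =>
    (h.differentiable_gradFactor p).hasFDerivAt
  have hx : ∀ x y z : ℝ, HasDerivAt (fun a => F !₂[a, y, z]) (K !₂[x, y, z] * x) x :=
    fun x y z => ((hFd _).comp_hasDerivAt x (hasDerivAt_vec3_fst x y z)).congr_deriv (by
      simp [PiLp.inner_apply, Fin.sum_univ_three])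
  have hy : ∀ x y z : ℝ, HasDerivAt (fun a => F !₂[x, a, z]) (K !₂[x, y, z] * y) y :=
    fun x y z => ((hFd _).comp_hasDerivAt y (hasDerivAt_vec3_snd x y z)).congr_deriv (by
      simp [PiLp.inner_apply, Fin.sum_univ_three])
  have hz : ∀ x y z : ℝ, HasDerivAt (fun a => F !₂[x, y, a]) (K !₂[x, y, z] * z) z :=
    fun x y z => ((hFd _).comp_hasDerivAt z (hasDerivAt_vec3_trd x y z)).congr_deriv (by
      simp [PiLp.inner_apply, Fin.sum_univ_three])
  have hFs : ContDiff ℝ (⊤ : ℕ∞) (fun p : ℝ × ℝ × ℝ => F !₂[p.1, p.2.1, p.2.2]) :=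
    h.contDiff_radialExtension.comp contDiff_vec3
  have hKc : Continuous (fun p : ℝ × ℝ × ℝ => K !₂[p.1, p.2.1, p.2.2]) :=
    h.differentiable_gradFactor.continuous.comp contDiff_vec3.continuous
  obtain ⟨R, C, hR, hC, hdec⟩ := h.exists_decay
  have hsq : ∀ r, R ≤ r → u r ^ 2 ≤ C ^ 2 * rexp (-r) := fun r hr => by
    calc u r ^ 2 ≤ (C * rexp (-r / 2)) ^ 2 :=
          pow_le_pow_left₀ (h.pos r (by linarith)).le (hdec r hr).1 2
      _ = C ^ 2 * rexp (-r) := by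
          rw [mul_pow, ← Real.exp_nat_mul]
          congr 2
          push_cast
          ring
  refine ⟨hFs, fun x y z => h.pos _ (norm_nonneg _), ⟨u, fun x y z => (hQ x y z).symm⟩, ?_, ?_, ?_,
    ?_⟩
  · simp only [← hQ]
    exact h.tendsto.comp tendsto_sqrt_sum_sq_cocompact
  · refine integrable_of_le_exp (hFs.continuous.pow 2) (R := R) (C := C ^ 2) fun p hp => ?_
    beta_reduce
    rw [← hQ, abs_of_nonneg (sq_nonneg _)]
    exact hsq _ hp
  · simp only [pdx, pdy, pdz, (hx _ _ _).deriv, (hy _ _ _).deriv, (hz _ _ _).deriv]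
    refine integrable_of_le_exp ((((hKc.mul continuous_fst).pow 2).add
      ((hKc.mul (continuous_fst.comp continuous_snd)).pow 2)).add
        ((hKc.mul (continuous_snd.comp continuous_snd)).pow 2)) (R := R) (C := 4 * C ^ 2) fun p hp => ?_
    set r := √(p.1 ^ 2 + p.2.1 ^ 2 + p.2.2 ^ 2) with hr
    have hr0 : 0 < r := by linarith
    have hn : ‖!₂[p.1, p.2.1, p.2.2]‖ = r := norm_vec3 _ _ _
    have hKr : K !₂[p.1, p.2.1, p.2.2] = du r / r := by
      rw [← hn]
      exact h.gradFactor_eq (norm_pos_iff.1 (by rw [hn]; exact hr0))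
    have hr2 : p.1 ^ 2 + p.2.1 ^ 2 + p.2.2 ^ 2 = r ^ 2 := by
      rw [hr, Real.sq_sqrt (by positivity)]
    have he : (K !₂[p.1, p.2.1, p.2.2] * p.1) ^ 2 + (K !₂[p.1, p.2.1, p.2.2] * p.2.1) ^ 2 +
        (K !₂[p.1, p.2.1, p.2.2] * p.2.2) ^ 2 = |du r| ^ 2 := by
      calc _ = K !₂[p.1, p.2.1, p.2.2] ^ 2 * (p.1 ^ 2 + p.2.1 ^ 2 + p.2.2 ^ 2) := by ring
        _ = |du r| ^ 2 := by
          rw [hr2, hKr, sq_abs]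
          field_simp
    rw [he, abs_of_nonneg (sq_nonneg _)]
    have h1 : |du r| ^ 2 ≤ (2 * u r) ^ 2 := pow_le_pow_left₀ (abs_nonneg _) (hdec r hp).2 2
    linarith [hsq r hp]
  · intro x y z
    set p := !₂[x, y, z] with hp
    have hxx := ((hKd _).comp_hasDerivAt x (hasDerivAt_vec3_fst x y z)).mul (hasDerivAt_id x)
    have hyy := ((hKd _).comp_hasDerivAt y (hasDerivAt_vec3_snd x y z)).mul (hasDerivAt_id y)
    have hzz := ((hKd _).comp_hasDerivAt z (hasDerivAt_vec3_trd x y z)).mul (hasDerivAt_id z)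
    have e : p = x • !₂[1, 0, 0] + y • !₂[0, 1, 0] + z • !₂[0, 0, 1] := by
      ext i
      fin_cases i <;> simp [hp]
    have h1 := h.fderiv_gradFactor_self p
    have h2 : fderiv ℝ K p p = x * fderiv ℝ K p !₂[1, 0, 0] + y * fderiv ℝ K p !₂[0, 1, 0]
        + z * fderiv ℝ K p !₂[0, 0, 1] := by
      refine (congrArg (fderiv ℝ K p) e).trans ?_
      simp only [map_add, map_smul, smul_eq_mul]
    have h3 : lap3 (fun x y z => F !₂[x, y, z]) x y z =
        3 * K p + fderiv ℝ K p p := by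
      simp only [lap3, (hx _ _ _).deriv, (hy _ _ _).deriv, (hz _ _ _).deriv]
      rw [h2]
      refine (congrArg₂ _ (congrArg₂ _ hxx.deriv hyy.deriv) hzz.deriv).trans ?_
      simp
      ring
    rw [h3, h1]
    ring

end IsDecayingProfile

/-! ### From a ground state to its profile -/

/-- Second derivative of a radial function in a direction orthogonal to the position. -/
lemma deriv_deriv_comp_sqrt {U : ℝ → ℝ} (hU : ContDiff ℝ (⊤ : ℕ∞) U) {r : ℝ} (hr : 0 < r) :
    deriv (fun b => deriv (fun b' => U (√(r ^ 2 + b' ^ 2))) b) 0 = deriv U r / r := by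
  have hU1 : Differentiable ℝ U := hU.differentiable (by simp)
  have hU2 : Differentiable ℝ (deriv U) :=
    (contDiff_infty_iff_deriv.1 hU).2.differentiable (by simp)
  have hpos : ∀ b : ℝ, 0 < r ^ 2 + b ^ 2 := fun b => by positivity
  have hs : ∀ b : ℝ, HasDerivAt (fun b => √(r ^ 2 + b ^ 2)) (b / √(r ^ 2 + b ^ 2)) b := fun b =>
    ((((hasDerivAt_pow 2 b).const_add (r ^ 2)).sqrt (hpos b).ne')).congr_deriv (by
      simp
      field_simp)
  have h1 : ∀ b : ℝ, deriv (fun b' => U (√(r ^ 2 + b' ^ 2))) b =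
      b * (deriv U (√(r ^ 2 + b ^ 2)) / √(r ^ 2 + b ^ 2)) := fun b => by
    refine (((hU1 _).hasDerivAt.comp b (hs b)).congr_deriv ?_).deriv
    ring
  simp only [h1]
  have h2 : DifferentiableAt ℝ (fun b => deriv U (√(r ^ 2 + b ^ 2)) / √(r ^ 2 + b ^ 2)) 0 :=
    ((hU2 _).comp 0 (hs 0).differentiableAt).div (hs 0).differentiableAt
      (Real.sqrt_pos.2 (hpos 0)).ne'
  have h3 := ((hasDerivAt_id (0 : ℝ)).mul h2.hasDerivAt).deriv
  refine h3.trans ?_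
  simp [Real.sqrt_sq hr.le]

namespace IsGroundState

variable {Q : ℝ → ℝ → ℝ → ℝ}

lemma eq_comp_sqrt (h : IsGroundState Q) (x y z : ℝ) :
    Q x y z = Q (√(x ^ 2 + y ^ 2 + z ^ 2)) 0 0 := by
  obtain ⟨q, hq⟩ := h.2.2.1
  rw [hq, hq (√(x ^ 2 + y ^ 2 + z ^ 2)), Real.sq_sqrt (by positivity)]
  simp

/-- The restriction of a ground state to a ray is a decaying profile. -/
theorem isDecayingProfile (h : IsGroundState Q) :
    IsDecayingProfile (fun r => Q r 0 0) (deriv fun r => Q r 0 0) := by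
  set U : ℝ → ℝ := fun r => Q r 0 0 with hUdef
  have hU : ContDiff ℝ (⊤ : ℕ∞) U :=
    h.1.comp (contDiff_id.prodMk (contDiff_const (c := ((0 : ℝ), (0 : ℝ)))))
  have hU1 : Differentiable ℝ U := hU.differentiable (by simp)
  have hdU : ContDiff ℝ (⊤ : ℕ∞) (deriv U) := (contDiff_infty_iff_deriv.1 hU).2
  have heven : (fun r => U (-r)) = U := by
    ext r
    simp only [hUdef]
    rw [h.eq_comp_sqrt, h.eq_comp_sqrt r]
    simp
  have hdU0 : deriv U 0 = 0 := by
    have h1 : deriv (fun r => U (-r)) 0 = -deriv U (-0) := deriv_comp_neg U 0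
    rw [heven, neg_zero] at h1
    linarith
  refine ⟨hU.continuous.continuousOn, ?_, fun r _ => (hU1 r).hasDerivAt, fun r hr => ?_,
    fun r _ => h.2.1 r 0 0, ?_⟩
  · have := hdU.continuous.tendsto 0
    rw [hdU0] at this
    exact this.mono_left nhdsWithin_le_nhds
  · have h1 := h.2.2.2.2.2.2 r 0 0
    have hy : ∀ b, Q r b 0 = U (√(r ^ 2 + b ^ 2)) := fun b => by
      rw [h.eq_comp_sqrt]
      simp [hUdef]
    have hz : ∀ b, Q r 0 b = U (√(r ^ 2 + b ^ 2)) := fun b => by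
      rw [h.eq_comp_sqrt]
      simp [hUdef]
    rw [lap3] at h1
    simp only [hy, hz, deriv_deriv_comp_sqrt hU hr] at h1
    refine ((hdU.differentiable (by simp) r).hasDerivAt).congr_deriv ?_
    have h2 : -(deriv (deriv U) r + deriv U r / r + deriv U r / r) + U r - U r ^ 2 = 0 := by
      have h3 : √(r ^ 2 + 0 ^ 2) = r := by simp [Real.sqrt_sq hr.le]
      rwa [h3] at h1
    linear_combination -h2
  · have h1 : Tendsto (fun r : ℝ => (r, (0 : ℝ), (0 : ℝ))) atTop (cocompact (ℝ × ℝ × ℝ)) := by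
      rw [← Metric.cobounded_eq_cocompact, ← tendsto_norm_atTop_iff_cobounded]
      refine tendsto_atTop_mono (fun r => ?_) tendsto_id
      exact (le_abs_self r).trans (le_max_left _ _)
    exact h.2.2.2.1.comp h1

end IsGroundState

/-- existence and uniqueness of the ground state of −ΔQ + Q − Q² = 0. -/
theorem zk_ground_state_exists_unique :
    ∃ Q : ℝ → ℝ → ℝ → ℝ, IsGroundState Q ∧
      ∀ Q' : ℝ → ℝ → ℝ → ℝ, IsGroundState Q' → Q' = Q := by
  obtain ⟨u, du, h⟩ := exists_isDecayingProfile
  refine ⟨_, h.isGroundState, fun Q' hQ' => ?_⟩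
  ext x y z
  rw [hQ'.eq_comp_sqrt]
  exact hQ'.isDecayingProfile.eqOn h (Real.sqrt_nonneg _)
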